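/- Assume the Riemann Hypothesis. Fix ε > 0, a weight W as described, and real numbers c₁, c₂ with 1 < c₁ < c₂ < 2. Then for all large real numbers y > x > 0, C₄ := (1/(2πi))² ∫_{Re s₁ = c₁} ∫_{Re s₂ = c₂} (ζ(3−s₁−s₂) ζ(2−s₁) ζ(2−s₂) / (ζ(4−(s₁+s₂)) ζ(s₁) ζ(s₂))) · y^{3−s₁−s₂} x^{s₁+s₂} Ŵ(3−s₁−s₂) Ŵ(s₁) Ŵ(s₂) ds₂ ds₁ satisfies |C₄| ≪ y^{−1/2+ε} x^{7/2−ε}, with an implied constant depending only on ε, c₁, c₂ and W. -/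

import Mathlib

open Complex Filter

/-- The Ramanujan sum `c_q(n) = ∑_{a mod q, gcd(a,q)=1} e(na/q)`. -/
noncomputable def ramanujanSum (q n : ℕ) : ℂ :=
  ∑ a ∈ (Finset.range q).filter (fun a => Nat.Coprime a q),
    Complex.exp (2 * Real.pi * Complex.I * (((n * a : ℕ) : ℂ) / (q : ℂ)))

/-- A smooth weight function attached to a parameter `U ≥ 2`: `0 ≤ W ≤ 1`, supported in
`[1/(2U), 1 + 1/(2U)]`, equal to `1` on `[1/U, 1]`, with `j`-th derivative `≪_j U^j`. -/
structure Weight (U : ℝ) : Type where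
  toFun : ℝ → ℝ
  smooth : ContDiff ℝ (⊤ : ℕ∞) toFun
  nonneg : ∀ t, 0 ≤ toFun t
  le_one : ∀ t, toFun t ≤ 1
  support_subset : ∀ t, t ∉ Set.Icc (1 / (2 * U)) (1 + 1 / (2 * U)) → toFun t = 0
  eq_one : ∀ t ∈ Set.Icc (1 / U) 1, toFun t = 1
  deriv_bound : ∀ j : ℕ, ∃ Cj : ℝ, ∀ t, |iteratedDeriv j toFun t| ≤ Cj * U ^ j

/-- The Mellin transform `Ŵ(s) = ∫_0^∞ W(t) t^{s-1} dt`. -/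
noncomputable def mellinW (W : ℝ → ℝ) (s : ℂ) : ℂ :=
  ∫ t in Set.Ioi (0 : ℝ), (W t : ℂ) * (t : ℂ) ^ (s - 1)

/-- `(1/(2πi)) ∫_{Re s = c} f(s) ds`, the normalized vertical line integral. -/
noncomputable def VI (c : ℝ) (f : ℂ → ℂ) : ℂ :=
  (1 / (2 * Real.pi * Complex.I)) * ∫ t : ℝ, f (c + t * Complex.I) * Complex.I

/-- The smoothed second moment `C(x,y) = ∑_n (∑_q c_q(n) W(q/x))² W(n/y)`. -/
noncomputable def Cxy {U : ℝ} (W : Weight U) (x y : ℝ) : ℂ :=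
  ∑' n : ℕ+, (∑' q : ℕ+, ramanujanSum q n * (W.toFun ((q : ℕ) / x) : ℂ)) ^ 2
    * (W.toFun ((n : ℕ) / y) : ℂ)

/-- The generalized divisor sum `σ_z(n) = ∑_{d ∣ n} d^z`. -/
noncomputable def sigmaC (z : ℂ) (n : ℕ) : ℂ := ∑ d ∈ n.divisors, (d : ℂ) ^ z

/-- A zero-free holomorphic function on a disc has a holomorphic logarithm. -/
theorem exists_log_ball {f : ℂ → ℂ} {R : ℝ} (hR : 0 < R)
    (hf : DifferentiableOn ℂ f (Metric.ball 0 R)) (h0 : ∀ z ∈ Metric.ball (0 : ℂ) R, f z ≠ 0) :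
    ∃ g : ℂ → ℂ, DifferentiableOn ℂ g (Metric.ball 0 R) ∧ g 0 = 0 ∧
      ∀ z ∈ Metric.ball (0 : ℂ) R, f z = f 0 * exp (g z) := by
  have hk : DifferentiableOn ℂ (fun z => deriv f z / f z) (Metric.ball 0 R) :=
    (hf.deriv Metric.isOpen_ball).div hf h0
  obtain ⟨g, hg0, hg⟩ := hk.isExactOn_ball.with_val_at 0 0
  refine ⟨g, fun z hz => (hg z hz).differentiableAt.differentiableWithinAt, hg0, fun z hz => ?_⟩
  have hF : ∀ w ∈ Metric.ball (0 : ℂ) R, HasDerivAt (fun w => f w * exp (-g w)) 0 w := by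
    intro w hw
    have h1 := (hf.differentiableAt (Metric.isOpen_ball.mem_nhds hw)).hasDerivAt
    refine (h1.mul (hg w hw).neg.cexp).congr_deriv ?_
    have hne := h0 w hw
    have : f w * (deriv f w / f w) = deriv f w := by field_simp
    linear_combination (-exp (-g w)) * this
  have := Metric.isOpen_ball.is_const_of_deriv_eq_zero (convex_ball (0 : ℂ) R).isPreconnected
    (fun w hw => (hF w hw).differentiableAt.differentiableWithinAt)
    (fun w hw => (hF w hw).deriv) hz (Metric.mem_ball_self hR)
  simp only [hg0, neg_zero, exp_zero, mul_one] at this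
  rw [← this, mul_assoc, ← exp_add]
  simp

/-- Lower bound for a zero-free function on a disc via the Borel–Carathéodory theorem. -/
theorem le_norm_of_ne_zero {f : ℂ → ℂ} {r R M m : ℝ} (hrR : r < R) (hR : 0 < R)
    (hf : DifferentiableOn ℂ f (Metric.ball 0 R)) (h0 : ∀ z ∈ Metric.ball (0 : ℂ) R, f z ≠ 0)
    (hM : ∀ z ∈ Metric.ball (0 : ℂ) R, ‖f z‖ ≤ M) (hm : 0 < m) (hm0 : m ≤ ‖f 0‖)
    {z : ℂ} (hz : ‖z‖ ≤ r) : m / (2 * M / m) ^ (2 * r / (R - r)) ≤ ‖f z‖ := by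
  have hr : 0 ≤ r := (norm_nonneg z).trans hz
  have hmM : m ≤ M := hm0.trans (hM 0 (Metric.mem_ball_self hR))
  obtain ⟨g, hg, hg0, hfg⟩ := exists_log_ball hR hf h0
  have h1 : 1 < 2 * M / m := by rw [lt_div_iff₀ hm]; linarith
  have hL : 0 < Real.log (2 * M / m) := Real.log_pos h1
  have hzR : z ∈ Metric.ball (0 : ℂ) R := by simpa using hz.trans_lt hrR
  have hmaps : Set.MapsTo g (Metric.ball 0 R) {z | z.re ≤ Real.log (2 * M / m)} := by
    intro w hw
    have h2 := hM w hw
    rw [hfg w hw, norm_mul, norm_exp] at h2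
    simp only [Set.mem_ofPred_eq]
    rw [Real.le_log_iff_exp_le (by linarith), le_div_iff₀ hm]
    nlinarith [Real.exp_pos (g w).re]
  have hB := borelCaratheodory_zero hL hg hmaps hR hzR hg0
  have hB' : ‖g z‖ ≤ Real.log (2 * M / m) * (2 * r / (R - r)) := by
    refine hB.trans ?_
    have : 2 * Real.log (2 * M / m) * ‖z‖ / (R - ‖z‖) =
      Real.log (2 * M / m) * (2 * ‖z‖ / (R - ‖z‖)) := by ring
    rw [this]
    have : 0 < R - r := by linarith
    gcongr
  rw [hfg z hzR, norm_mul, norm_exp, Real.rpow_def_of_pos (by linarith), div_eq_mul_inv,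
    ← Real.exp_neg]
  have := (abs_le.mp (abs_re_le_norm (g z))).1
  gcongr
  linarith

theorem norm_sub_conj_mul_eq {R : ℝ} {u z : ℂ} (hz : ‖z‖ = R) :
    ‖(R : ℂ) ^ 2 - starRingEnd ℂ u * z‖ = R * ‖z - u‖ := by
  have : (R : ℂ) ^ 2 = starRingEnd ℂ z * z := by
    rw [← hz, ← ofReal_pow, ← normSq_eq_norm_sq, normSq_eq_conj_mul_self]
  rw [this, ← sub_mul, norm_mul, hz, ← map_sub, RCLike.norm_conj, mul_comm]

/-- If `h * f` is bounded on a circle and `f` is bounded there and not too small at the centre,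
then `h` is bounded on smaller discs. -/
theorem norm_le_of_norm_mul_le {U : Set ℂ} (hU : IsOpen U) {r S R M Q : ℝ}
    (hrS : r < S) (hS : 0 < S) (hSR : S < R) (hRU : Metric.closedBall 0 R ⊆ U) (k : ℕ) :
    ∀ (f h : ℂ → ℂ) (m : ℝ), DifferentiableOn ℂ f U → DifferentiableOn ℂ h U →
      (∀ z, ‖z‖ = R → ‖f z‖ ≤ M) → (∀ z, ‖z‖ = R → ‖h z * f z‖ ≤ Q) → 0 < m → m ≤ ‖f 0‖ →
      M * (S / R) ^ k < m →
      ∀ z, ‖z‖ ≤ r → ‖h z‖ ≤ Q / m * (2 * M / m) ^ (2 * r / (S - r)) := by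
  have hR : 0 < R := hS.trans hSR
  have hmax : ∀ (f : ℂ → ℂ) (C : ℝ), DifferentiableOn ℂ f U → (∀ z, ‖z‖ = R → ‖f z‖ ≤ C) →
      ∀ z, ‖z‖ ≤ R → ‖f z‖ ≤ C := by
    intro f C hf hC z hz
    refine norm_le_of_forall_mem_frontier_norm_le (Metric.isBounded_ball (x := (0:ℂ)) (r := R))
      (DifferentiableOn.diffContOnCl ?_) ?_ ?_
    · rw [closure_ball _ hR.ne']; exact hf.mono hRU
    · rw [frontier_ball _ hR.ne']; intro w hw; exact hC w (by simpa using hw)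
    · rw [closure_ball _ hR.ne']; simpa using hz
  induction k with
  | zero =>
    intro f h m hf hh hM hQ hm hm0 hk z hz
    have := hmax f M hf hM 0 (by simpa using hR.le)
    simp at hk
    linarith
  | succ k ih =>
    intro f h m hf hh hM hQ hm hm0 hk z hz
    have hr : 0 ≤ r := (norm_nonneg z).trans hz
    have hfM := hmax f M hf hM
    have hmM : m ≤ M := hm0.trans (hfM 0 (by simpa using hR.le))
    have hQ0 : 0 ≤ Q := (norm_nonneg _).trans (hQ R (by simp [abs_of_pos hR]))
    by_cases hz0 : ∀ z ∈ Metric.ball (0 : ℂ) S, f z ≠ 0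
    · have h1 := le_norm_of_ne_zero hrS hS (hf.mono (fun w hw => hRU ?_)) hz0
        (fun w hw => hfM w ?_) hm hm0 hz
      · have h2 := hmax (fun z => h z * f z) Q (hh.mul hf) hQ z (by linarith)
        rw [norm_mul] at h2
        have h3 : 0 < (2 * M / m) ^ (2 * r / (S - r)) := by
          apply Real.rpow_pos_of_pos; have := hm.trans_le hmM; positivity
        calc ‖h z‖ = ‖h z‖ * (m / (2 * M / m) ^ (2 * r / (S - r))) *
              ((2 * M / m) ^ (2 * r / (S - r)) / m) := by field_simp
          _ ≤ ‖h z‖ * ‖f z‖ * ((2 * M / m) ^ (2 * r / (S - r)) / m) := by gcongr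
          _ ≤ Q * ((2 * M / m) ^ (2 * r / (S - r)) / m) := by gcongr
          _ = _ := by ring
      · simp at hw ⊢; linarith
      · simp at hw; linarith
    · push Not at hz0
      obtain ⟨u, hu, hfu⟩ := hz0
      have hu' : ‖u‖ < S := by simpa using hu
      have hu0 : u ≠ 0 := by rintro rfl; simp [hfu] at hm0; linarith
      set f₁ : ℂ → ℂ := fun z => dslope f u z * (((R : ℂ) ^ 2 - starRingEnd ℂ u * z) / R) with hf₁
      have hd : ∀ z, f z = (z - u) * dslope f u z := by
        intro z
        have := sub_smul_dslope f u z
        rw [hfu, sub_zero, smul_eq_mul] at this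
        exact this.symm
      have hn : ∀ z, ‖z‖ = R → ‖f₁ z‖ = ‖f z‖ := by
        intro z hz
        rw [hf₁, hd z]
        simp only [norm_mul, norm_div, norm_sub_conj_mul_eq hz, norm_real, Real.norm_eq_abs,
          abs_of_pos hR]
        field_simp
      have hf₁d : DifferentiableOn ℂ f₁ U := by
        refine DifferentiableOn.mul ?_ (by fun_prop)
        exact (differentiableOn_dslope (hU.mem_nhds (hRU (by simp; linarith)))).mpr hf
      have h0 : ‖f₁ 0‖ = ‖f 0‖ * (R / ‖u‖) := by
        rw [hf₁, hd 0]
        simp only [norm_mul, norm_div, mul_zero, sub_zero, zero_sub, norm_neg, norm_pow, norm_real,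
          Real.norm_eq_abs, abs_of_pos hR]
        field_simp
      have hRS : 1 ≤ R / S := by rw [le_div_iff₀ hS]; linarith
      have hm1 : m ≤ m * (R / S) := le_mul_of_one_le_right hm.le hRS
      have := ih f₁ h (m * (R / S)) hf₁d hh (fun z hz => (hn z hz).trans_le (hM z hz))
        (fun z hz => by rw [norm_mul, hn z hz, ← norm_mul]; exact hQ z hz) (by positivity)
        (by rw [h0]; gcongr) ?_ z hz
      · refine this.trans ?_
        have := hm.trans_le hmM
        gcongr
      · rw [pow_succ, ← mul_assoc] at hk
        calc M * (S / R) ^ k = M * (S / R) ^ k * (S / R) * (R / S) := by field_simp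
          _ < _ := by gcongr

/-- `‖ζ(s)‖⁻¹` is bounded on `Re s ≥ σ` for `σ > 1`. -/
theorem exists_norm_inv_riemannZeta_le {σ : ℝ} (hσ : 1 < σ) :
    ∃ C : ℝ, 0 < C ∧ ∀ s : ℂ, σ ≤ s.re → ‖(riemannZeta s)⁻¹‖ ≤ C := by
  set μ : ℕ → ℂ := fun n => (ArithmeticFunction.moebius n : ℂ) with hμ
  have hs : LSeriesSummable μ σ :=
    ArithmeticFunction.LSeriesSummable_moebius_iff.mpr (by simpa using hσ)
  refine ⟨(∑' n, ‖LSeries.term μ σ n‖) + 1, by positivity, fun s hs' => ?_⟩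
  have h1 := LSeries_one_mul_Lseries_moebius (s := s) (by linarith)
  rw [LSeries_one_eq_riemannZeta (by linarith)] at h1
  rw [inv_eq_of_mul_eq_one_right h1]
  have hle : ∀ n, ‖LSeries.term μ s n‖ ≤ ‖LSeries.term μ σ n‖ := fun n =>
    LSeries.norm_term_le_of_re_le_re μ (by simpa using hs') n
  have hsum : Summable fun n => ‖LSeries.term μ s n‖ :=
    Summable.of_nonneg_of_le (fun _ => norm_nonneg _) hle hs.norm
  calc ‖LSeries μ s‖ ≤ ∑' n, ‖LSeries.term μ s n‖ := norm_tsum_le_tsum_norm hsum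
    _ ≤ ∑' n, ‖LSeries.term μ σ n‖ := hsum.tsum_le_tsum hle hs.norm
    _ ≤ _ := by linarith

/-- Comparison of `Γ` at two points on the same horizontal line, via the beta integral. -/
theorem norm_Gamma_le {z : ℂ} (hz : 0 < z.re) {d : ℝ} (hd : 0 < d) :
    ‖Gamma z‖ ≤ Real.Gamma z.re / Real.Gamma (z.re + d) * ‖Gamma (z + d)‖ := by
  set B : ℝ := ∫ x in (0 : ℝ)..1, x ^ (z.re - 1) * (1 - x) ^ (d - 1) with hB
  have key : ∀ x ∈ Set.Ioo (0 : ℝ) 1, ∀ w : ℂ, w.re = z.re →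
      ‖(x : ℂ) ^ (w - 1) * (1 - x : ℂ) ^ ((d : ℂ) - 1)‖ =
        x ^ (z.re - 1) * (1 - x) ^ (d - 1) := by
    intro x hx w hw
    have h1 : (1 - x : ℂ) = ((1 - x : ℝ) : ℂ) := by push_cast; rfl
    rw [norm_mul, h1, norm_cpow_eq_rpow_re_of_pos hx.1,
      norm_cpow_eq_rpow_re_of_pos (by linarith [hx.2])]
    simp [hw]
  have hb : ‖betaIntegral z d‖ ≤ B := by
    rw [betaIntegral, hB, intervalIntegral.integral_of_le zero_le_one,
      intervalIntegral.integral_of_le zero_le_one, MeasureTheory.integral_Ioc_eq_integral_Ioo,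
      MeasureTheory.integral_Ioc_eq_integral_Ioo]
    refine (MeasureTheory.norm_integral_le_integral_norm _).trans_eq ?_
    exact MeasureTheory.setIntegral_congr_fun measurableSet_Ioo fun x hx => key x hx z rfl
  have hb' : betaIntegral z.re d = B := by
    rw [betaIntegral, hB, ← intervalIntegral.integral_ofReal]
    refine intervalIntegral.integral_congr fun x hx => ?_
    rw [Set.uIcc_of_le zero_le_one] at hx
    simp only [ofReal_mul]
    rw [ofReal_cpow hx.1, ofReal_cpow (by linarith [hx.2])]
    push_cast
    rfl
  have e1 := Gamma_mul_Gamma_eq_betaIntegral (s := z) (t := d) hz (by simpa using hd)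
  have e2 := Gamma_mul_Gamma_eq_betaIntegral (s := z.re) (t := d) (by simpa using hz)
    (by simpa using hd)
  rw [hb', ← ofReal_add, Gamma_ofReal, Gamma_ofReal, Gamma_ofReal, ← ofReal_mul,
    ← ofReal_mul, ofReal_inj] at e2
  have e3 := congrArg norm e1
  rw [norm_mul, norm_mul, Gamma_ofReal, norm_real, Real.norm_eq_abs,
    abs_of_pos (Real.Gamma_pos_of_pos hd)] at e3
  have hd' := Real.Gamma_pos_of_pos hd
  rw [← mul_le_mul_iff_left₀ hd', e3]
  calc ‖Gamma (z + d)‖ * ‖betaIntegral z d‖ ≤ ‖Gamma (z + d)‖ * B := by gcongr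
    _ = ‖Gamma (z + d)‖ * ((Real.Gamma (z.re + d) * B) / Real.Gamma (z.re + d)) := by field_simp
    _ = _ := by rw [← e2]; ring

theorem riemannZeta_mul_Gammaℝ {s : ℂ} (h0 : 0 < s.re) (h1 : s.re < 1) :
    riemannZeta s * Gammaℝ s = riemannZeta (1 - s) * Gammaℝ (1 - s) := by
  have hs0 : s ≠ 0 := by rintro rfl; simp at h0
  have hs1 : 1 - s ≠ 0 := by intro h; rw [sub_eq_zero] at h; simp [← h] at h1
  rw [riemannZeta_def_of_ne_zero hs0, riemannZeta_def_of_ne_zero hs1,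
    div_mul_cancel₀ _ (Gammaℝ_ne_zero_of_re_pos h0),
    div_mul_cancel₀ _ (Gammaℝ_ne_zero_of_re_pos (by simpa using h1)),
    completedRiemannZeta_one_sub]

theorem norm_Gammaℝ (s : ℂ) : ‖Gammaℝ s‖ = Real.pi ^ (-s.re / 2) * ‖Gamma (s / 2)‖ := by
  rw [Gammaℝ_def, norm_mul, norm_cpow_eq_rpow_re_of_pos Real.pi_pos]
  simp

theorem norm_Gammaℝ_conj (s : ℂ) : ‖Gammaℝ (starRingEnd ℂ s)‖ = ‖Gammaℝ s‖ := by
  rw [norm_Gammaℝ, norm_Gammaℝ]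
  have : starRingEnd ℂ s / 2 = starRingEnd ℂ (s / 2) := by rw [map_div₀, map_ofNat]
  rw [this, Gamma_conj, RCLike.norm_conj, conj_re]

/-- Left of the critical line, `1/ζ` is controlled by its values right of the critical line. -/
theorem exists_norm_inv_riemannZeta_le_of_lt_half {σ : ℝ} (h0 : 0 < σ) (h1 : σ < 1 / 2) :
    ∃ C : ℝ, 0 < C ∧ ∀ t : ℝ, ‖(riemannZeta (σ + t * I))⁻¹‖ ≤
      C * ‖(riemannZeta (1 - (σ + t * I)))⁻¹‖ := by
  set D : ℝ := Real.Gamma (σ / 2) / Real.Gamma (σ / 2 + (1 / 2 - σ)) with hD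
  set E : ℝ := D * Real.pi ^ (1 / 2 - σ) with hE
  have hEpos : 0 < E := by positivity
  refine ⟨E, hEpos, fun t => ?_⟩
  set s : ℂ := σ + t * I with hs
  have hsre : s.re = σ := by simp [hs]
  have key := riemannZeta_mul_Gammaℝ (s := s) (by linarith) (by linarith)
  have hG : ‖Gammaℝ s‖ ≤ E * ‖Gammaℝ (1 - s)‖ := by
    rw [← norm_Gammaℝ_conj (1 - s), norm_Gammaℝ, norm_Gammaℝ]
    have h2 := norm_Gamma_le (z := s / 2) (by simp; linarith) (d := 1 / 2 - σ) (by linarith)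
    have h3 : starRingEnd ℂ (1 - s) / 2 = s / 2 + ((1 / 2 - σ : ℝ) : ℂ) := by
      apply Complex.ext <;> simp [hs]; ring
    have h4 : (s / 2).re = σ / 2 := by simp [hsre]
    rw [h4] at h2
    rw [h3]
    simp only [conj_re, sub_re, one_re, hsre]
    calc Real.pi ^ (-σ / 2) * ‖Gamma (s / 2)‖
        ≤ Real.pi ^ (-σ / 2) * (D * ‖Gamma (s / 2 + ((1 / 2 - σ : ℝ) : ℂ))‖) := by gcongr
      _ = _ := by
        have : Real.pi ^ (-σ / 2) = Real.pi ^ (1 / 2 - σ) * Real.pi ^ (-(1 - σ) / 2) := by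
          rw [← Real.rpow_add Real.pi_pos]; congr 1; ring
        rw [this, hE]; ring
  have hG1 : 0 < ‖Gammaℝ s‖ := norm_pos_iff.mpr (Gammaℝ_ne_zero_of_re_pos (by linarith))
  have hG2 : 0 < ‖Gammaℝ (1 - s)‖ :=
    norm_pos_iff.mpr (Gammaℝ_ne_zero_of_re_pos (by simp; linarith))
  have key' := congrArg norm key
  rw [norm_mul, norm_mul] at key'
  rw [norm_inv, norm_inv]
  rcases eq_or_ne (riemannZeta (1 - s)) 0 with h | h
  · rw [h] at key' ⊢
    rw [norm_zero, zero_mul] at key'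
    have : ‖riemannZeta s‖ = 0 := by
      rcases mul_eq_zero.mp key' with h | h
      · exact h
      · linarith
    simp [this]
  · have hz : 0 < ‖riemannZeta (1 - s)‖ := norm_pos_iff.mpr h
    have : ‖riemannZeta (1 - s)‖ ≤ E * ‖riemannZeta s‖ := by
      rw [← mul_le_mul_iff_left₀ hG2, ← key']
      calc _ ≤ ‖riemannZeta s‖ * (E * ‖Gammaℝ (1 - s)‖) := by gcongr
        _ = _ := by ring
    have hz2 : 0 < ‖riemannZeta s‖ := by
      by_contra hh
      have : ‖riemannZeta s‖ = 0 := le_antisymm (not_lt.mp hh) (norm_nonneg _)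
      nlinarith
    rw [inv_le_iff_one_le_mul₀ hz2, mul_assoc, mul_comm (_⁻¹), ← mul_assoc, ← div_eq_mul_inv,
      le_div_iff₀ hz]
    linarith

/-- The fractional part integral in the analytic continuation of `ζ`. -/
noncomputable def fractIntegral (s : ℂ) : ℂ :=
  ∫ t in Set.Ioi (1 : ℝ), ((Int.fract t : ℝ) : ℂ) * (t : ℂ) ^ (-(s + 1))

theorem norm_fractIntegral_le {s : ℂ} (hs : 0 < s.re) : ‖fractIntegral s‖ ≤ 1 / s.re := by
  have h1 : (∫ t in Set.Ioi (1 : ℝ), t ^ (-(s.re + 1))) = 1 / s.re := by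
    rw [integral_Ioi_rpow_of_lt (by linarith) zero_lt_one]
    simp
  rw [← h1]
  refine MeasureTheory.norm_integral_le_of_norm_le
    (integrableOn_Ioi_rpow_of_lt (by linarith) zero_lt_one) ?_
  refine MeasureTheory.ae_restrict_of_forall_mem measurableSet_Ioi fun t ht => ?_
  have ht0 : (0 : ℝ) < t := zero_lt_one.trans ht
  rw [norm_mul, norm_cpow_eq_rpow_re_of_pos ht0, norm_real, Real.norm_eq_abs,
    abs_of_nonneg (Int.fract_nonneg t)]
  simp only [neg_re, add_re, one_re]
  exact mul_le_of_le_one_left (Real.rpow_nonneg ht0.le _) (Int.fract_lt_one t).le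

theorem differentiableAt_fractIntegral {s : ℂ} (hs : 0 < s.re) :
    DifferentiableAt ℂ fractIntegral s := by
  set φ : ℝ → ℂ := (Set.Ioi (1 : ℝ)).indicator fun t => ((Int.fract t : ℝ) : ℂ) with hφ
  have hmeas : Measurable φ :=
    (measurable_ofReal.comp measurable_fract).indicator measurableSet_Ioi
  have hb : ∀ t, ‖φ t‖ ≤ 1 := by
    intro t
    by_cases h : t ∈ Set.Ioi (1 : ℝ)
    · rw [hφ, Set.indicator_of_mem h, norm_real, Real.norm_eq_abs,
        abs_of_nonneg (Int.fract_nonneg t)]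
      exact (Int.fract_lt_one t).le
    · rw [hφ, Set.indicator_of_notMem h]; simp
  have hf : fractIntegral = fun s => mellin φ (-s) := by
    funext s
    rw [fractIntegral, mellin]
    have : ∀ t : ℝ, (t : ℂ) ^ (-s - 1) • φ t = (Set.Ioi (1 : ℝ)).indicator
        (fun t : ℝ => ((Int.fract t : ℝ) : ℂ) * (t : ℂ) ^ (-(s + 1))) t := by
      intro t
      by_cases h : t ∈ Set.Ioi (1 : ℝ)
      · rw [hφ, Set.indicator_of_mem h, Set.indicator_of_mem h, smul_eq_mul, mul_comm]
        congr 2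
        ring
      · rw [hφ, Set.indicator_of_notMem h, Set.indicator_of_notMem h, smul_zero]
    simp_rw [this]
    rw [MeasureTheory.setIntegral_indicator measurableSet_Ioi]
    congr 2
    rw [Set.inter_eq_right.mpr (Set.Ioi_subset_Ioi zero_le_one)]
  rw [hf]
  refine DifferentiableAt.comp (g := mellin φ) s ?_ differentiableAt_id.neg
  refine mellin_differentiableAt_of_isBigO_rpow (a := 0) (b := -s.re - 1) ?_ ?_ (by simpa) ?_
    (by simp)
  · refine (MeasureTheory.locallyIntegrable_const (1 : ℝ)).locallyIntegrableOn _ |>.mono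
      hmeas.aestronglyMeasurable ?_
    exact Eventually.of_forall fun t => by simpa using hb t
  · refine Asymptotics.IsBigO.of_bound 1 (Eventually.of_forall fun t => ?_)
    simpa using hb t
  · refine Asymptotics.IsBigO.of_bound 1 ?_
    filter_upwards [Ioo_mem_nhdsGT (zero_lt_one' ℝ)] with t ht
    rw [hφ, Set.indicator_of_notMem (by simpa using ht.2.le)]
    simp

theorem riemannZeta_eq_sub_fractIntegral {s : ℂ} (hs : 1 < s.re) :
    riemannZeta s = s / (s - 1) - s * fractIntegral s := by
  have h1 := LSeries_eq_mul_integral_of_nonneg (fun _ => 1) zero_le_one hs ?_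
    (fun _ => zero_le_one)
  · have h2 : LSeries (fun n => (((fun _ => 1 : ℕ → ℝ) n : ℝ) : ℂ)) s = riemannZeta s := by
      rw [← LSeries_one_eq_riemannZeta hs]
      congr 1
    rw [h2] at h1
    rw [h1]
    have hs1 : s - 1 ≠ 0 := by
      intro h; rw [sub_eq_zero] at h; simp [h] at hs
    have h3 : s / (s - 1) = s * ∫ t in Set.Ioi (1 : ℝ), (t : ℂ) ^ (-s) := by
      rw [integral_Ioi_cpow_of_lt (by simpa) zero_lt_one]
      have : -s + 1 ≠ 0 := by intro h; apply hs1; linear_combination -h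
      simp
      field_simp
      ring
    rw [h3, ← mul_sub, fractIntegral, ← MeasureTheory.integral_sub]
    · congr 1
      refine MeasureTheory.setIntegral_congr_fun measurableSet_Ioi fun t ht => ?_
      have ht0 : (0 : ℝ) < t := zero_lt_one.trans ht
      have ht1 : (t : ℂ) ≠ 0 := by exact_mod_cast ht0.ne'
      have h4 : (∑ k ∈ Finset.Icc 1 ⌊t⌋₊, (((fun _ => 1 : ℕ → ℝ) k : ℝ) : ℂ)) =
          (t : ℂ) - ((Int.fract t : ℝ) : ℂ) := by
        have : (⌊t⌋₊ : ℝ) = t - Int.fract t := by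
          rw [natCast_floor_eq_intCast_floor ht0.le]
          linarith [Int.floor_add_fract t]
        rw [← ofReal_sub, ← this]
        simp
      have h5 : (t : ℂ) ^ (-s) = t * (t : ℂ) ^ (-(s + 1)) := by
        rw [show -s = 1 + -(s + 1) by ring, cpow_add _ _ ht1, cpow_one]
      simp only [h4, h5]
      ring
    · exact integrableOn_Ioi_cpow_of_lt (by simpa) zero_lt_one
    · refine MeasureTheory.Integrable.mono' (g := fun t : ℝ => t ^ (-(s.re + 1)))
        (integrableOn_Ioi_rpow_of_lt (by linarith) zero_lt_one) ?_ ?_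
      · refine MeasureTheory.AEStronglyMeasurable.mul ?_ ?_
        · exact (measurable_ofReal.comp measurable_fract).aestronglyMeasurable
        · exact (integrableOn_Ioi_cpow_of_lt (by simp; linarith) zero_lt_one).aestronglyMeasurable
      · refine MeasureTheory.ae_restrict_of_forall_mem measurableSet_Ioi fun t ht => ?_
        have ht0 : (0 : ℝ) < t := zero_lt_one.trans ht
        rw [norm_mul, norm_cpow_eq_rpow_re_of_pos ht0, norm_real, Real.norm_eq_abs,
          abs_of_nonneg (Int.fract_nonneg t)]
        simp only [neg_re, add_re, one_re]
        exact mul_le_of_le_one_left (Real.rpow_nonneg ht0.le _) (Int.fract_lt_one t).le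
  · refine Asymptotics.IsBigO.of_bound 1 (Eventually.of_forall fun n => ?_)
    simp

theorem riemannZeta₁_eq_sub_fractIntegral {s : ℂ} (hs : 0 < s.re) :
    riemannZeta₁ s = s - s * (s - 1) * fractIntegral s := by
  have hopen : IsOpen {s : ℂ | 0 < s.re} := isOpen_lt continuous_const continuous_re
  have hpre : IsPreconnected {s : ℂ | 0 < s.re} :=
    (convex_halfSpace_re_gt 0).isPreconnected
  have hA : AnalyticOnNhd ℂ (fun s => s - s * (s - 1) * fractIntegral s) {s : ℂ | 0 < s.re} := by
    refine DifferentiableOn.analyticOnNhd (fun s hs => ?_) hopen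
    have := differentiableAt_fractIntegral hs
    exact DifferentiableAt.differentiableWithinAt (by fun_prop)
  have hB : AnalyticOnNhd ℂ riemannZeta₁ {s : ℂ | 0 < s.re} :=
    differentiable_riemannZeta₁.differentiableOn.analyticOnNhd hopen
  refine hB.eqOn_of_preconnected_of_eventuallyEq hA hpre (z₀ := 2) (by simp) ?_ hs
  have : {s : ℂ | 1 < s.re} ∈ nhds (2 : ℂ) :=
    (isOpen_lt continuous_const continuous_re).mem_nhds (by simp)
  filter_upwards [this] with z hz
  have hz1 : z - 1 ≠ 0 := by
    intro h; rw [sub_eq_zero] at h; simp [h] at hz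
  have h1 := riemannZeta_eq_inv_sub_mul (s := z) (sub_ne_zero.mp hz1)
  rw [riemannZeta_eq_sub_fractIntegral hz] at h1
  have : riemannZeta₁ z = (z - 1) * ((z - 1)⁻¹ * riemannZeta₁ z) := by field_simp
  rw [this, ← h1]
  field_simp

theorem norm_le_abs_re_add_abs_im_le {s : ℂ} {a : ℝ} (ha : 1 ≤ a) (h1 : |s.re| ≤ a) :
    ‖s‖ ≤ a * (1 + |s.im|) := by
  have := norm_le_abs_re_add_abs_im s
  nlinarith [abs_nonneg s.im]

theorem norm_riemannZeta₁_le_of_quarter_le {s : ℂ} (h1 : 1 / 4 ≤ s.re) (h2 : s.re ≤ 4) :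
    ‖riemannZeta₁ s‖ ≤ 84 * (1 + |s.im|) ^ 2 := by
  have hs : 0 < s.re := by linarith
  rw [riemannZeta₁_eq_sub_fractIntegral hs]
  have hF : ‖fractIntegral s‖ ≤ 4 := by
    refine (norm_fractIntegral_le hs).trans ?_
    rw [div_le_iff₀ hs]; linarith
  have hτ : 1 ≤ 1 + |s.im| := by linarith [abs_nonneg s.im]
  have hs1 : ‖s‖ ≤ 4 * (1 + |s.im|) :=
    norm_le_abs_re_add_abs_im_le (by norm_num) (abs_le.mpr ⟨by linarith, h2⟩)
  have hs2 : ‖s - 1‖ ≤ 5 * (1 + |s.im|) := by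
    have := norm_sub_le s 1
    rw [norm_one] at this
    linarith
  calc ‖s - s * (s - 1) * fractIntegral s‖ ≤ ‖s‖ + ‖s‖ * ‖s - 1‖ * ‖fractIntegral s‖ := by
        refine (norm_sub_le _ _).trans ?_
        rw [norm_mul, norm_mul]
    _ ≤ 4 * (1 + |s.im|) + (4 * (1 + |s.im|)) * (5 * (1 + |s.im|)) * 4 := by gcongr
    _ ≤ 84 * (1 + |s.im|) ^ 2 := by nlinarith

theorem riemannZeta_eq_mul_Gammaℝ_div {s : ℂ} (h0 : s ≠ 0) (h1 : s ≠ 1)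
    (h2 : s.re < 1) : riemannZeta s = riemannZeta (1 - s) * Gammaℝ (1 - s) / Gammaℝ s := by
  have h3 : Gammaℝ (1 - s) ≠ 0 := Gammaℝ_ne_zero_of_re_pos (by simpa using h2)
  rw [riemannZeta_def_of_ne_zero h0, riemannZeta_def_of_ne_zero (sub_ne_zero.mpr h1.symm),
    completedRiemannZeta_one_sub, div_mul_cancel₀ _ h3]

theorem ne_neg_natCast_of_pos {x : ℝ} (hx : 0 < x) (m : ℕ) : x ≠ -m := by
  have : (0 : ℝ) ≤ m := m.cast_nonneg
  linarith

theorem exists_norm_riemannZeta₁_le :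
    ∃ C > 0, ∀ s : ℂ, -1 ≤ s.re → s.re ≤ 4 → ‖riemannZeta₁ s‖ ≤ C * (1 + |s.im|) ^ 4 := by
  obtain ⟨B, hB⟩ := isCompact_Icc.exists_bound_of_continuousOn
    (s := Set.Icc (-1 : ℝ) (1 / 4))
    (f := fun σ : ℝ => Real.Gamma ((1 - σ) / 2) / Real.Gamma (σ / 2 + 2)) (by
      intro σ hσ
      have h1 : 0 < (1 - σ) / 2 := by linarith [hσ.2]
      have h2 : 0 < σ / 2 + 2 := by linarith [hσ.1]
      refine ContinuousAt.continuousWithinAt (ContinuousAt.div ?_ ?_ (Real.Gamma_pos_of_pos h2).ne')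
      · exact (Real.differentiableAt_Gamma (ne_neg_natCast_of_pos h1)).continuousAt.comp'
          (f := fun σ : ℝ => (1 - σ) / 2) (by fun_prop)
      · exact (Real.differentiableAt_Gamma (ne_neg_natCast_of_pos h2)).continuousAt.comp'
          (f := fun σ : ℝ => σ / 2 + 2) (by fun_prop))
  refine ⟨84 + ‖riemannZeta₁ 0‖ + Real.pi * 2 * 2 * 84 * |B|, by positivity, ?_⟩
  intro s hs1 hs2
  have hτ : 1 ≤ 1 + |s.im| := by linarith [abs_nonneg s.im]
  have key : ∀ K, ‖riemannZeta₁ s‖ ≤ K * (1 + |s.im|) ^ 4 →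
      K ≤ 84 + ‖riemannZeta₁ 0‖ + Real.pi * 2 * 2 * 84 * |B| →
      ‖riemannZeta₁ s‖ ≤ (84 + ‖riemannZeta₁ 0‖ + Real.pi * 2 * 2 * 84 * |B|) *
        (1 + |s.im|) ^ 4 := by
    intro K h1 h2
    exact h1.trans (by gcongr)
  have hpi := Real.pi_pos
  rcases le_total (1 / 4) s.re with h | h
  · refine key 84 ((norm_riemannZeta₁_le_of_quarter_le h hs2).trans ?_) ?_
    · gcongr
      · norm_num
    · have : 0 ≤ ‖riemannZeta₁ 0‖ + Real.pi * 2 * 2 * 84 * |B| := by positivity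
      linarith
  by_cases h0 : s = 0
  · subst h0
    refine key ‖riemannZeta₁ 0‖ ?_ ?_
    · simp
    · have : 0 ≤ Real.pi * 2 * 2 * 84 * |B| := by positivity
      linarith
  have h1 : s ≠ 1 := by rintro rfl; norm_num at h
  refine key (Real.pi * 2 * 2 * 84 * |B|) ?_ (by linarith [norm_nonneg (riemannZeta₁ 0)])
  have hre : s.re < 1 := by linarith
  have hG2 : Complex.Gamma (s / 2 + 2) ≠ 0 :=
    Gamma_ne_zero_of_re_pos (by simp; linarith)
  have hpos1 : s / 2 + 1 ≠ 0 := by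
    intro h
    have := congrArg re h
    simp at this
    linarith
  have hGam : Complex.Gamma (s / 2 + 2) = (s / 2 + 1) * (s / 2) * Complex.Gamma (s / 2) := by
    rw [show s / 2 + 2 = (s / 2 + 1) + 1 by ring, Gamma_add_one _ hpos1,
      Gamma_add_one _ (div_ne_zero h0 two_ne_zero)]
    ring
  have hGs : Complex.Gamma (s / 2) ≠ 0 := fun h => hG2 (by rw [hGam, h, mul_zero])
  have e1 : riemannZeta₁ s = (s - 1) * riemannZeta s := by
    rw [riemannZeta_eq_inv_sub_mul h1, mul_inv_cancel_left₀ (sub_ne_zero.mpr h1)]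
  have e2 : riemannZeta (1 - s) = (-s)⁻¹ * riemannZeta₁ (1 - s) := by
    rw [riemannZeta_eq_inv_sub_mul (by simpa using h0)]
    congr 2; ring
  have e3 : ‖riemannZeta₁ s‖ = ‖s - 1‖ * ‖s‖⁻¹ * ‖riemannZeta₁ (1 - s)‖ * ‖Gammaℝ (1 - s)‖ /
      ‖Gammaℝ s‖ := by
    rw [e1, riemannZeta_eq_mul_Gammaℝ_div h0 h1 hre, e2]
    simp only [norm_mul, norm_div, norm_inv, norm_neg]
    ring
  have e4 : ‖Gammaℝ s‖ = Real.pi ^ (-s.re / 2) * (‖Complex.Gamma (s / 2 + 2)‖ /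
      (‖s / 2 + 1‖ * (‖s‖ / 2))) := by
    rw [norm_Gammaℝ, hGam]
    simp only [norm_mul, norm_div, RCLike.norm_ofNat]
    have := norm_pos_iff.mpr hpos1
    have := norm_pos_iff.mpr h0
    generalize ‖s / 2 + 1‖ = p at *
    field_simp
  have e5 : ‖Complex.Gamma ((1 - s) / 2)‖ ≤ |B| * ‖Complex.Gamma (s / 2 + 2)‖ := by
    have h3 : ‖Complex.Gamma ((1 - s) / 2)‖ =
        ‖Complex.Gamma ((1 - (starRingEnd ℂ) s) / 2)‖ := by
      rw [← norm_conj (Complex.Gamma ((1 - s) / 2)), ← Gamma_conj, map_div₀, map_sub,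
        map_one, map_ofNat]
    have h4 := norm_Gamma_le (z := (1 - (starRingEnd ℂ) s) / 2) (d := 3 / 2 + s.re)
      (by simp; linarith) (by linarith)
    have h5 : (1 - (starRingEnd ℂ) s) / 2 + ((3 / 2 + s.re : ℝ) : ℂ) = s / 2 + 2 := by
      apply Complex.ext
      · simp
        ring
      · simp
    have h6 : ((1 - (starRingEnd ℂ) s) / 2).re = (1 - s.re) / 2 := by simp
    rw [h5, h6, show (1 - s.re) / 2 + (3 / 2 + s.re) = s.re / 2 + 2 by ring] at h4
    rw [h3]
    refine h4.trans ?_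
    gcongr
    exact (le_abs_self _).trans ((hB s.re ⟨hs1, h⟩).trans (le_abs_self _))
  have e6 : ‖Gammaℝ (1 - s)‖ ≤ |B| * ‖Complex.Gamma (s / 2 + 2)‖ := by
    rw [norm_Gammaℝ]
    refine (mul_le_of_le_one_left (norm_nonneg _) ?_).trans e5
    refine Real.rpow_le_one_of_one_le_of_nonpos (by linarith [Real.pi_gt_three]) ?_
    simp; linarith
  have e7 : Real.pi ^ (s.re / 2) ≤ Real.pi := by
    conv_rhs => rw [← Real.rpow_one Real.pi]
    exact Real.rpow_le_rpow_of_exponent_le (by linarith [Real.pi_gt_three]) (by linarith)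
  have b1 : ‖s - 1‖ ≤ 2 * (1 + |s.im|) := by
    have := norm_le_abs_re_add_abs_im_le (s := s - 1) (a := 2) (by norm_num)
      (by simp only [sub_re, one_re]; exact abs_le.mpr ⟨by linarith, by linarith⟩)
    simpa using this
  have b2 : ‖s / 2 + 1‖ ≤ 2 * (1 + |s.im|) := by
    have := norm_le_abs_re_add_abs_im_le (s := s / 2 + 1) (a := 2) (by norm_num)
      (by simp; exact abs_le.mpr ⟨by linarith, by linarith⟩)
    simp at this
    refine this.trans ?_
    rw [abs_div, abs_two]
    linarith [abs_nonneg s.im]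
  have b3 : ‖riemannZeta₁ (1 - s)‖ ≤ 84 * (1 + |s.im|) ^ 2 := by
    have := norm_riemannZeta₁_le_of_quarter_le (s := 1 - s) (by simp; linarith)
      (by simp; linarith)
    simpa using this
  have hg := norm_pos_iff.mpr hG2
  have e8 : Real.pi ^ (-s.re / 2) = (Real.pi ^ (s.re / 2))⁻¹ := by
    rw [← Real.rpow_neg hpi.le]; congr 1; ring
  calc ‖riemannZeta₁ s‖ = ‖s - 1‖ * ‖s / 2 + 1‖ / 2 * ‖riemannZeta₁ (1 - s)‖ *
        Real.pi ^ (s.re / 2) * (‖Gammaℝ (1 - s)‖ / ‖Complex.Gamma (s / 2 + 2)‖) := by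
        rw [e3, e4, e8]
        field_simp
    _ ≤ (2 * (1 + |s.im|)) * (2 * (1 + |s.im|)) / 2 * (84 * (1 + |s.im|) ^ 2) *
        Real.pi * |B| := by
        gcongr
        rwa [div_le_iff₀ hg]
    _ ≤ Real.pi * 2 * 2 * 84 * |B| * (1 + |s.im|) ^ 4 := by
        have : 0 ≤ Real.pi * 84 * 2 * |B| * (1 + |s.im|) ^ 4 := by positivity
        nlinarith

theorem exists_le_norm_riemannZeta₁ :
    ∃ m > 0, ∀ t : ℝ, m ≤ ‖riemannZeta₁ (2 + t * I)‖ := by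
  obtain ⟨C, hC, h⟩ := exists_norm_inv_riemannZeta_le (σ := 3 / 2) (by norm_num)
  refine ⟨C⁻¹, inv_pos.mpr hC, fun t => ?_⟩
  have hne : (2 + t * I : ℂ) ≠ 1 := by
    intro h
    have := congrArg re h
    norm_num at this
  have h0 : riemannZeta (2 + t * I) ≠ 0 := riemannZeta_ne_zero_of_one_lt_re (by norm_num)
  have h1 := h (2 + t * I) (by norm_num)
  rw [norm_inv, inv_le_comm₀ (norm_pos_iff.mpr h0) hC] at h1
  have h2 : riemannZeta₁ (2 + t * I) = (2 + t * I - 1) * riemannZeta (2 + t * I) := by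
    rw [riemannZeta_eq_inv_sub_mul hne, mul_inv_cancel_left₀ (sub_ne_zero.mpr hne)]
  have h3 : 1 ≤ ‖(2 + t * I - 1 : ℂ)‖ := by
    refine le_trans ?_ (abs_re_le_norm _)
    norm_num
  rw [h2, norm_mul]
  nlinarith [norm_nonneg (riemannZeta (2 + t * I))]

theorem one_add_abs_rpow_le {u v : ℝ} (h : |u - v| ≤ 2) (N : ℝ) :
    (1 + |u|) ^ N ≤ 3 ^ |N| * (1 + |v|) ^ N := by
  have hu := abs_nonneg u
  have hv := abs_nonneg v
  have h1 : 1 + |u| ≤ 3 * (1 + |v|) := by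
    have := abs_sub_abs_le_abs_sub u v
    linarith
  have h2 : 1 + |v| ≤ 3 * (1 + |u|) := by
    have := abs_sub_abs_le_abs_sub v u
    rw [abs_sub_comm] at this
    linarith
  rcases le_total 0 N with hN | hN
  · rw [abs_of_nonneg hN, ← Real.mul_rpow (by norm_num) (by positivity)]
    exact Real.rpow_le_rpow (by positivity) h1 hN
  · rw [abs_of_nonpos hN]
    have h3 : (1 + |u|) ^ N ≤ ((1 + |v|) / 3) ^ N :=
      Real.rpow_le_rpow_of_nonpos (by positivity) (by linarith) hN
    rwa [Real.div_rpow (by positivity) (by norm_num), div_eq_mul_inv,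
      ← Real.rpow_neg (by norm_num), mul_comm] at h3

/-- Division by `riemannZeta₁` in a half plane costs only a fixed power of the height. -/
theorem exists_norm_le_of_norm_mul_riemannZeta₁_le {a b : ℝ} (ha : 0 < a) (hab : a < b)
    (hb : b < 2) :
    ∃ A : ℝ, ∀ (h : ℂ → ℂ) (N K : ℝ), DifferentiableOn ℂ h {w | a < w.re} →
      (∀ w : ℂ, a < w.re → w.re ≤ 4 → ‖h w * riemannZeta₁ w‖ ≤ K * (1 + |w.im|) ^ N) →
      ∃ K', ∀ w : ℂ, b ≤ w.re → w.re ≤ 2 → ‖h w‖ ≤ K' * (1 + |w.im|) ^ (N + A) := by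
  obtain ⟨C, hC, hCb⟩ := exists_norm_riemannZeta₁_le
  obtain ⟨m, hm, hmb⟩ := exists_le_norm_riemannZeta₁
  set r := 2 - b with hr
  set S := 2 - (a + 2 * b) / 3 with hS
  set R := 2 - (2 * a + b) / 3 with hR
  set e := 2 * r / (S - r) with he
  refine ⟨4 * e, fun h N K hh hq => ?_⟩
  refine ⟨|K| * 3 ^ |N| / m * (162 * C / m) ^ e, fun w hw1 hw2 => ?_⟩
  set t := w.im with ht
  have him : ∀ z : ℂ, ‖z‖ = R → |(z + (2 + t * I)).im - t| ≤ 2 := by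
    intro z hz
    have := abs_im_le_norm z
    simp
    linarith
  have hre : ∀ z : ℂ, ‖z‖ ≤ R → a < (z + (2 + t * I)).re ∧ (z + (2 + t * I)).re ≤ 4 := by
    intro z hz
    have := abs_le.mp ((abs_re_le_norm z).trans hz)
    simp
    constructor <;> linarith
  have hopen : IsOpen ((fun z : ℂ => z + (2 + t * I)) ⁻¹' {w | a < w.re}) :=
    (isOpen_lt continuous_const continuous_re).preimage (by fun_prop)
  have hSR : S / R < 1 := by rw [div_lt_one] <;> linarith
  have hSR0 : 0 ≤ S / R := div_nonneg (by linarith) (by linarith)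
  obtain ⟨k, hk⟩ : ∃ k : ℕ, 81 * C * (1 + |t|) ^ 4 * (S / R) ^ k < m := by
    have := (tendsto_pow_atTop_nhds_zero_of_lt_one hSR0 hSR).const_mul
      (81 * C * (1 + |t|) ^ 4)
    rw [mul_zero] at this
    exact (this.eventually (gt_mem_nhds hm)).exists
  have key := norm_le_of_norm_mul_le hopen (r := r) (S := S) (R := R)
    (M := 81 * C * (1 + |t|) ^ 4) (Q := |K| * (3 ^ |N| * (1 + |t|) ^ N)) (by linarith)
    (by linarith) (by linarith)
    (fun z hz => (hre z (by simpa using hz)).1) k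
    (fun z => riemannZeta₁ (z + (2 + t * I))) (fun z => h (z + (2 + t * I))) m
    (differentiable_riemannZeta₁.comp (by fun_prop)).differentiableOn
    (hh.comp (by fun_prop) fun z hz => hz)
    (fun z hz => by
      refine (hCb _ (by linarith [(hre z hz.le).1]) (hre z hz.le).2).trans ?_
      have := one_add_abs_rpow_le (him z hz) 4
      norm_num at this
      norm_cast at this
      have h1 : (z + (2 + t * I)).im = z.im + t := by simp
      rw [h1]
      linarith [mul_le_mul_of_nonneg_left this hC.le])
    (fun z hz => by
      refine (hq _ (hre z hz.le).1 (hre z hz.le).2).trans ?_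
      have := one_add_abs_rpow_le (him z hz) N
      gcongr
      exact le_abs_self K)
    hm (by simpa using hmb t) hk (w - (2 + t * I)) (by
      have : w - (2 + t * I) = ((w.re - 2 : ℝ) : ℂ) := by
        apply Complex.ext <;> simp [ht]
      rw [this, norm_real, Real.norm_eq_abs, abs_of_nonpos (by linarith)]
      linarith)
  simp only [sub_add_cancel] at key
  refine key.trans (le_of_eq ?_)
  rw [← he, show 2 * (81 * C * (1 + |t|) ^ 4) / m = (162 * C / m) * (1 + |t|) ^ (4 : ℝ) by
    norm_cast; ring, Real.mul_rpow (by positivity) (by positivity),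
    ← Real.rpow_mul (by positivity), Real.rpow_add (by positivity)]
  ring

section Mellin

variable {p q : ℝ} {φ : ℝ → ℝ}

theorem mellinW_eq_intervalIntegral (hp : 0 < p) (hpq : p ≤ q)
    (hφ : ∀ t ∉ Set.Icc p q, φ t = 0) (s : ℂ) :
    mellinW φ s = ∫ t in (p / 2)..(q + 1), (φ t : ℂ) * (t : ℂ) ^ (s - 1) := by
  rw [mellinW, intervalIntegral.integral_of_le (by linarith)]
  refine (MeasureTheory.setIntegral_eq_of_subset_of_forall_sdiff_eq_zero measurableSet_Ioi
    (fun t ht => ?_) fun t ht => ?_)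
  · simp only [Set.mem_Ioc] at ht
    simp only [Set.mem_Ioi]
    linarith
  · rw [hφ t, ofReal_zero, zero_mul]
    intro h
    refine ht.2 ⟨by linarith [h.1], by linarith [h.2]⟩

theorem continuousOn_ofReal_mul_cpow (hp : 0 < p) (hφ : Continuous φ) (s : ℂ) :
    ContinuousOn (fun t : ℝ => (φ t : ℂ) * (t : ℂ) ^ s) (Set.Ici p) := by
  refine (continuous_ofReal.comp hφ).continuousOn.mul fun t ht => ?_
  have : (0 : ℝ) < t := hp.trans_le ht
  exact (continuousAt_ofReal_cpow_const _ _ (Or.inr this.ne')).continuousWithinAt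

theorem mul_mellinW (hp : 0 < p) (hpq : p ≤ q) (hs : ContDiff ℝ (⊤ : ℕ∞) φ)
    (hφ : ∀ t ∉ Set.Icc p q, φ t = 0) (hφ' : ∀ t ∉ Set.Icc p q, deriv φ t = 0) (s : ℂ) :
    s * mellinW φ s = -mellinW (deriv φ) (s + 1) := by
  have hc : Continuous (deriv φ) := hs.continuous_deriv (by simp)
  have hsub : Set.uIcc (p / 2) (q + 1) ⊆ Set.Ici (p / 2) := by
    rw [Set.uIcc_of_le (by linarith)]
    exact Set.Icc_subset_Ici_self
  have hp2 : 0 < p / 2 := by linarith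
  rw [mellinW_eq_intervalIntegral hp hpq hφ, mellinW_eq_intervalIntegral hp hpq hφ',
    ← intervalIntegral.integral_const_mul, eq_neg_iff_add_eq_zero,
    ← intervalIntegral.integral_add]
  · rw [intervalIntegral.integral_eq_sub_of_hasDerivAt
      (f := fun t : ℝ => (φ t : ℂ) * (t : ℂ) ^ s)]
    · rw [hφ (q + 1) (fun h => by linarith [h.2]), hφ (p / 2) (fun h => by linarith [h.1])]
      simp
    · intro t ht
      have ht0 : 0 < t := hp2.trans_le (hsub ht)
      have h1 : HasDerivAt (fun t : ℝ => (φ t : ℂ)) ((deriv φ t : ℝ) : ℂ) t :=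
        ((hs.differentiable (by simp)) t).hasDerivAt.ofReal_comp
      have h2 : HasDerivAt (fun t : ℝ => (t : ℂ) ^ s) (s * (t : ℂ) ^ (s - 1)) t := by
        have := (hasDerivAt_id (t : ℂ)).cpow_const (c := s)
          (Or.inl (by simpa using ht0)) |>.comp_ofReal
        simpa using this
      refine (h1.mul h2).congr_deriv ?_
      rw [add_sub_cancel_right]
      ring
    · refine ContinuousOn.intervalIntegrable (ContinuousOn.add ?_ ?_)
      · exact continuousOn_const.mul
          ((continuousOn_ofReal_mul_cpow hp2 hs.continuous _).mono hsub)
      · exact (continuousOn_ofReal_mul_cpow hp2 hc _).mono hsub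
  · exact (continuousOn_const.mul
      ((continuousOn_ofReal_mul_cpow hp2 hs.continuous _).mono hsub)).intervalIntegrable
  · exact ((continuousOn_ofReal_mul_cpow hp2 hc _).mono hsub).intervalIntegrable

theorem exists_norm_mellinW_le (hp : 0 < p) (hpq : p ≤ q) (hs : Continuous φ)
    (hφ : ∀ t ∉ Set.Icc p q, φ t = 0) (α β : ℝ) :
    ∃ C, ∀ s : ℂ, α ≤ s.re → s.re ≤ β → ‖mellinW φ s‖ ≤ C := by
  obtain ⟨B, hB⟩ := (isCompact_Icc.prod isCompact_Icc).exists_bound_of_continuousOn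
    (s := Set.Icc α β ×ˢ Set.Icc (p / 2) (q + 1))
    (f := fun z : ℝ × ℝ => φ z.2 * z.2 ^ (z.1 - 1)) (by
      refine (hs.comp continuous_snd).continuousOn.mul ?_
      refine ContinuousOn.rpow continuous_snd.continuousOn (by fun_prop) fun z hz => Or.inl ?_
      have := hz.2.1
      intro h
      linarith)
  refine ⟨B * |q + 1 - p / 2|, fun s h1 h2 => ?_⟩
  rw [mellinW_eq_intervalIntegral hp hpq hφ]
  refine intervalIntegral.norm_integral_le_of_norm_le_const fun t ht => ?_
  rw [Set.uIoc_of_le (by linarith)] at ht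
  have ht0 : 0 < t := by linarith [ht.1]
  have := hB (s.re, t) ⟨⟨h1, h2⟩, ⟨ht.1.le, ht.2⟩⟩
  rw [norm_mul, Real.norm_eq_abs (t ^ _), abs_of_pos (Real.rpow_pos_of_pos ht0 _)] at this
  rw [norm_mul, norm_cpow_eq_rpow_re_of_pos ht0, norm_real]
  simpa using this

theorem exists_norm_pow_mul_mellinW_le (hp : 0 < p) (hpq : p ≤ q) (n : ℕ) :
    ∀ φ : ℝ → ℝ, ContDiff ℝ (⊤ : ℕ∞) φ → (∀ t ∉ Set.Icc p q, φ t = 0) → ∀ α β : ℝ,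
      ∃ C, ∀ s : ℂ, α ≤ s.re → s.re ≤ β → ‖s‖ ^ n * ‖mellinW φ s‖ ≤ C := by
  induction n with
  | zero =>
    intro φ hs hφ α β
    simpa using exists_norm_mellinW_le hp hpq hs.continuous hφ α β
  | succ n ih =>
    intro φ hs hφ α β
    have hφ' : ∀ t ∉ Set.Icc p q, deriv φ t = 0 := by
      intro t ht
      have : φ =ᶠ[nhds t] fun _ => 0 := by
        filter_upwards [isClosed_Icc.isOpen_compl.mem_nhds ht] with u hu using hφ u hu
      rw [this.deriv_eq, deriv_const]
    have hs' : ContDiff ℝ (⊤ : ℕ∞) (deriv φ) :=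
      (contDiff_infty_iff_deriv.mp hs).2
    obtain ⟨C, hC⟩ := ih (deriv φ) hs' hφ' (α + 1) (β + 1)
    obtain ⟨D, hD⟩ := exists_norm_mellinW_le hp hpq hs'.continuous hφ' (α + 1) (β + 1)
    refine ⟨2 ^ n * (C + D), fun s h1 h2 => ?_⟩
    have h3 := hC (s + 1) (by simpa) (by simpa)
    have h4 := hD (s + 1) (by simpa) (by simpa)
    have h5 : ‖s‖ ^ n ≤ 2 ^ n * (‖s + 1‖ ^ n + 1) := by
      have h6 : ‖s‖ ≤ ‖s + 1‖ + 1 := by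
        have := norm_sub_le (s + 1) 1
        simpa using this
      calc ‖s‖ ^ n ≤ (‖s + 1‖ + 1) ^ n := by gcongr
        _ ≤ 2 ^ (n - 1) * (‖s + 1‖ ^ n + 1 ^ n) := add_pow_le (by positivity) (by norm_num) n
        _ ≤ 2 ^ n * (‖s + 1‖ ^ n + 1) := by
          rw [one_pow]
          gcongr
          · norm_num
          · omega
    calc ‖s‖ ^ (n + 1) * ‖mellinW φ s‖ = ‖s‖ ^ n * ‖s * mellinW φ s‖ := by
          rw [norm_mul]; ring
      _ = ‖s‖ ^ n * ‖mellinW (deriv φ) (s + 1)‖ := by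
          rw [mul_mellinW hp hpq hs hφ hφ', norm_neg]
      _ ≤ 2 ^ n * (‖s + 1‖ ^ n + 1) * ‖mellinW (deriv φ) (s + 1)‖ := by gcongr
      _ = 2 ^ n * (‖s + 1‖ ^ n * ‖mellinW (deriv φ) (s + 1)‖ + ‖mellinW (deriv φ) (s + 1)‖) := by
          ring
      _ ≤ 2 ^ n * (C + D) := by gcongr

/-- The Mellin transform of a smooth weight decays rapidly in vertical strips. -/
theorem exists_norm_mellinW_le_rpow (hp : 0 < p) (hpq : p ≤ q) (hs : ContDiff ℝ (⊤ : ℕ∞) φ)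
    (hφ : ∀ t ∉ Set.Icc p q, φ t = 0) (α β N : ℝ) :
    ∃ C > 0, ∀ s : ℂ, α ≤ s.re → s.re ≤ β → ‖mellinW φ s‖ ≤ C * (1 + |s.im|) ^ N := by
  obtain ⟨n, hn⟩ := exists_nat_ge (-N)
  obtain ⟨C, hC⟩ := exists_norm_pow_mul_mellinW_le hp hpq n φ hs hφ α β
  obtain ⟨D, hD⟩ := exists_norm_mellinW_le hp hpq hs.continuous hφ α β
  refine ⟨2 ^ n * (|C| + |D|) + 1, by positivity, fun s h1 h2 => ?_⟩
  have hτ : 1 ≤ 1 + |s.im| := by linarith [abs_nonneg s.im]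
  have h3 : (1 + |s.im|) ^ n ≤ 2 ^ n * (‖s‖ ^ n + 1) := by
    calc (1 + |s.im|) ^ n ≤ (‖s‖ + 1) ^ n := by
          have := abs_im_le_norm s
          exact pow_le_pow_left₀ (by positivity) (by linarith) n
      _ ≤ 2 ^ (n - 1) * (‖s‖ ^ n + 1 ^ n) := add_pow_le (by positivity) (by norm_num) n
      _ ≤ 2 ^ n * (‖s‖ ^ n + 1) := by
        rw [one_pow]
        gcongr
        · norm_num
        · omega
  have h4 : (1 + |s.im|) ^ n * ‖mellinW φ s‖ ≤ 2 ^ n * (|C| + |D|) + 1 := by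
    calc (1 + |s.im|) ^ n * ‖mellinW φ s‖ ≤ 2 ^ n * (‖s‖ ^ n + 1) * ‖mellinW φ s‖ := by gcongr
      _ = 2 ^ n * (‖s‖ ^ n * ‖mellinW φ s‖ + ‖mellinW φ s‖) := by ring
      _ ≤ 2 ^ n * (|C| + |D|) := by
        gcongr
        · exact (hC s h1 h2).trans (le_abs_self _)
        · exact (hD s h1 h2).trans (le_abs_self _)
      _ ≤ _ := by linarith
  have h5 : (1 + |s.im|) ^ (-(n : ℝ)) ≤ (1 + |s.im|) ^ N :=
    Real.rpow_le_rpow_of_exponent_le hτ (by linarith)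
  rw [Real.rpow_neg (by positivity), Real.rpow_natCast] at h5
  calc ‖mellinW φ s‖ = (1 + |s.im|) ^ n * ‖mellinW φ s‖ * ((1 + |s.im|) ^ n)⁻¹ := by
        field_simp
    _ ≤ (2 ^ n * (|C| + |D|) + 1) * (1 + |s.im|) ^ N := by gcongr

theorem differentiable_mellinW (hp : 0 < p) (hs : Continuous φ)
    (hφ : ∀ t ∉ Set.Icc p q, φ t = 0) : Differentiable ℂ (mellinW φ) := by
  intro s
  have h : mellinW φ = mellin fun t => (φ t : ℂ) := by
    funext s
    simp only [mellinW, mellin, smul_eq_mul, mul_comm]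
  rw [h]
  refine mellin_differentiableAt_of_isBigO_rpow (a := s.re + 1) (b := s.re - 1) ?_ ?_
    (by linarith) ?_ (by linarith)
  · exact (continuous_ofReal.comp hs).locallyIntegrable.locallyIntegrableOn _
  · refine Asymptotics.IsBigO.of_bound 1 ?_
    filter_upwards [eventually_gt_atTop q, eventually_gt_atTop 0] with t ht ht0
    rw [hφ t fun h => by linarith [h.2]]
    simp
  · refine Asymptotics.IsBigO.of_bound 1 ?_
    filter_upwards [Ioo_mem_nhdsGT hp] with t ht
    rw [hφ t fun h => by linarith [h.1, ht.2]]
    simp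

end Mellin

section VerticalIntegrals

theorem integrable_one_add_abs_rpow :
    MeasureTheory.Integrable fun t : ℝ => (1 + |t|) ^ (-2 : ℝ) := by
  simpa using integrable_one_add_norm (E := ℝ) (μ := MeasureTheory.volume) (r := 2) (by simp)

theorem integrable_vertical {G : ℂ → ℂ} {a K : ℝ} (hG : Continuous fun t : ℝ => G (a + t * I))
    (hK : ∀ t : ℝ, ‖G (a + t * I)‖ ≤ K * (1 + |t|) ^ (-2 : ℝ)) :
    MeasureTheory.Integrable fun t : ℝ => G (a + t * I) :=
  (integrable_one_add_abs_rpow.const_mul K).mono' hG.aestronglyMeasurable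
    (Eventually.of_forall hK)

theorem integral_vertical_eq {G : ℂ → ℂ} {a b K : ℝ} (hab : a ≤ b)
    (hG : DifferentiableOn ℂ G (re ⁻¹' Set.Icc a b))
    (hK : ∀ s : ℂ, a ≤ s.re → s.re ≤ b → ‖G s‖ ≤ K * (1 + |s.im|) ^ (-2 : ℝ)) :
    ∫ t : ℝ, G (a + t * I) = ∫ t : ℝ, G (b + t * I) := by
  have hline : ∀ c ∈ Set.Icc a b, MeasureTheory.Integrable fun t : ℝ => G (c + t * I) := by
    intro c hc
    refine integrable_vertical (K := K) ?_ fun t => ?_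
    · exact hG.continuousOn.comp_continuous (by fun_prop) fun t => by simpa using hc
    · simpa using hK (c + t * I) (by simpa using hc.1) (by simpa using hc.2)
  have hv : ∀ c ∈ Set.Icc a b, Tendsto (fun T : ℝ => ∫ t in (-T)..T, G (c + t * I)) atTop
      (nhds (∫ t : ℝ, G (c + t * I))) := fun c hc =>
    MeasureTheory.intervalIntegral_tendsto_integral (hline c hc) tendsto_neg_atTop_atBot tendsto_id
  have hdecay : Tendsto (fun T : ℝ => K * (1 + T) ^ (-2 : ℝ) * |b - a|) atTop (nhds 0) := by
    have h1 : Tendsto (fun T : ℝ => (1 + T) ^ (-2 : ℝ)) atTop (nhds 0) :=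
      (tendsto_rpow_neg_atTop two_pos).comp (tendsto_atTop_add_const_left _ _ tendsto_id)
    simpa using (h1.const_mul K).mul_const |b - a|
  have hh : ∀ σ : ℝ → ℝ, (∀ T, |σ T| = |T|) →
      Tendsto (fun T : ℝ => ∫ u in a..b, G (u + (σ T : ℝ) * I)) atTop (nhds 0) := by
    intro σ hσ
    refine squeeze_zero_norm' ?_ hdecay
    filter_upwards [eventually_ge_atTop 0] with T hT
    refine intervalIntegral.norm_integral_le_of_norm_le_const fun u hu => ?_
    rw [Set.uIoc_of_le hab] at hu
    have := hK (u + (σ T : ℝ) * I) (by simpa using hu.1.le) (by simpa using hu.2)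
    simpa [hσ, abs_of_nonneg hT] using this
  have hrect : ∀ T : ℝ, (∫ u in a..b, G (u + (-T : ℝ) * I)) - (∫ u in a..b, G (u + (T : ℝ) * I)) +
      I • (∫ t in (-T)..T, G (b + t * I)) - I • (∫ t in (-T)..T, G (a + t * I)) = 0 := by
    intro T
    have := integral_boundary_rect_eq_zero_of_differentiableOn G (a + (-T : ℝ) * I)
      (b + (T : ℝ) * I) (hG.mono fun z hz => by
        rw [mem_reProdIm] at hz
        have := hz.1
        simp only [add_re, ofReal_re, mul_re, I_re, mul_zero, ofReal_im, I_im, mul_one, sub_self,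
          add_zero] at this
        rwa [Set.uIcc_of_le hab] at this)
    simpa using this
  have hlim := (((hh (fun T => -T) (by simp)).sub (hh (fun T => T) (by simp))).add
    ((hv b ⟨hab, le_rfl⟩).const_smul I)).sub ((hv a ⟨le_rfl, hab⟩).const_smul I)
  have h0 := tendsto_nhds_unique hlim
    (tendsto_const_nhds.congr fun T => (hrect T).symm)
  rw [sub_zero, zero_add, sub_eq_zero] at h0
  exact (smul_right_injective ℂ I_ne_zero h0).symm

theorem VI_eq_integral (c : ℝ) (f : ℂ → ℂ) :
    VI c f = (1 / (2 * Real.pi)) * ∫ t : ℝ, f (c + t * I) := by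
  rw [VI, MeasureTheory.integral_mul_const]
  have := Real.pi_ne_zero
  field_simp [I_ne_zero]

theorem norm_VI_le {c : ℝ} {f : ℂ → ℂ} {g : ℝ → ℝ} (hg : MeasureTheory.Integrable g)
    (h : ∀ᵐ t : ℝ, ‖f (c + t * I)‖ ≤ g t) : ‖VI c f‖ ≤ ∫ t, g t := by
  have h1 := MeasureTheory.norm_integral_le_of_norm_le hg h
  have h2 : ‖(1 / (2 * Real.pi) : ℂ)‖ ≤ 1 := by
    have : (1 / (2 * Real.pi) : ℂ) = ((1 / (2 * Real.pi) : ℝ) : ℂ) := by push_cast; rfl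
    rw [this, norm_real, Real.norm_eq_abs, abs_of_nonneg (by positivity)]
    rw [div_le_one (by positivity)]
    linarith [Real.pi_gt_three]
  rw [VI_eq_integral, norm_mul]
  exact (mul_le_of_le_one_left (norm_nonneg _) h2).trans h1

theorem VI_congr_ae {c : ℝ} {f g : ℂ → ℂ} (h : ∀ᵐ t : ℝ, f (c + t * I) = g (c + t * I)) :
    VI c f = VI c g := by
  rw [VI_eq_integral, VI_eq_integral, MeasureTheory.integral_congr_ae h]

theorem VI_comm {a b : ℝ} {F : ℂ → ℂ → ℂ}
    (h : MeasureTheory.Integrable fun z : ℝ × ℝ => F (a + z.1 * I) (b + z.2 * I)) :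
    VI a (fun s => VI b fun u => F s u) = VI b fun u => VI a fun s => F s u := by
  simp only [VI_eq_integral, MeasureTheory.integral_const_mul]
  rw [MeasureTheory.integral_integral_swap h]

/-- Trivial bound for a double vertical integral with a coupled factor. -/
theorem norm_VI_VI_mul_le {A E : ℂ → ℂ} {a b K L : ℝ}
    (ha : ∀ t : ℝ, ‖A (a + t * I)‖ ≤ K * (1 + |t|) ^ (-2 : ℝ))
    (hb : ∀ t : ℝ, ‖A (b + t * I)‖ ≤ K * (1 + |t|) ^ (-2 : ℝ))
    (hE : ∀ t : ℝ, ‖E ((a + b : ℝ) + t * I)‖ ≤ L) :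
    ‖VI a fun s => VI b fun u => A s * A u * E (s + u)‖ ≤
      (K * ∫ t : ℝ, (1 + |t|) ^ (-2 : ℝ)) ^ 2 * L := by
  have h1 : ∀ t : ℝ, ‖VI b fun u => A (a + t * I) * A u * E (a + t * I + u)‖ ≤
      (K * (∫ t : ℝ, (1 + |t|) ^ (-2 : ℝ)) * L) * (K * (1 + |t|) ^ (-2 : ℝ)) := by
    intro t
    refine (norm_VI_le (g := fun u => K * (1 + |t|) ^ (-2 : ℝ) * L * K * (1 + |u|) ^ (-2 : ℝ))
      (integrable_one_add_abs_rpow.const_mul _) (Eventually.of_forall fun u => ?_)).trans ?_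
    · have h2 : (a + t * I + (b + u * I) : ℂ) = ((a + b : ℝ) : ℂ) + ((t + u : ℝ) : ℂ) * I := by
        push_cast; ring
      rw [norm_mul, norm_mul, h2]
      have h3 := (norm_nonneg _).trans (ha t)
      calc _ ≤ (K * (1 + |t|) ^ (-2 : ℝ)) * (K * (1 + |u|) ^ (-2 : ℝ)) * L := by
            have h4 := (norm_nonneg _).trans (hb u)
            exact mul_le_mul (mul_le_mul (ha t) (hb u) (norm_nonneg _) h3) (hE _)
              (norm_nonneg _) (mul_nonneg h3 h4)
        _ = _ := by ring
    · rw [MeasureTheory.integral_const_mul]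
      exact le_of_eq (by ring)
  refine (norm_VI_le ((integrable_one_add_abs_rpow.const_mul K).const_mul _)
    (Eventually.of_forall h1)).trans ?_
  rw [MeasureTheory.integral_const_mul, MeasureTheory.integral_const_mul]
  exact le_of_eq (by ring)

theorem VI_eq_of_differentiableOn {G : ℂ → ℂ} {a b K : ℝ} (hab : a ≤ b)
    (hG : DifferentiableOn ℂ G (re ⁻¹' Set.Icc a b))
    (hK : ∀ s : ℂ, a ≤ s.re → s.re ≤ b → ‖G s‖ ≤ K * (1 + |s.im|) ^ (-2 : ℝ)) :
    VI a G = VI b G := by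
  rw [VI_eq_integral, VI_eq_integral, integral_vertical_eq hab hG hK]

/-- Moving both lines of integration to the right. -/
theorem VI_VI_mul_eq {A E : ℂ → ℂ} {a b a' b' K L : ℝ} (haa : a ≤ a') (hbb : b ≤ b')
    (hA : DifferentiableOn ℂ A (re ⁻¹' Set.Icc a a'))
    (hB : DifferentiableOn ℂ A (re ⁻¹' Set.Icc b b'))
    (hE : DifferentiableOn ℂ E (re ⁻¹' Set.Icc (a + b) (a' + b')))
    (hAK : ∀ s : ℂ, s.re ∈ Set.Icc a a' → ‖A s‖ ≤ K * (1 + |s.im|) ^ (-2 : ℝ))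
    (hBK : ∀ s : ℂ, s.re ∈ Set.Icc b b' → ‖A s‖ ≤ K * (1 + |s.im|) ^ (-2 : ℝ))
    (hEL : ∀ s : ℂ, s.re ∈ Set.Icc (a + b) (a' + b') → ‖E s‖ ≤ L) :
    (VI a fun s => VI b fun u => A s * A u * E (s + u)) =
      VI b' fun u => VI a' fun s => A u * A s * E (u + s) := by
  have hpos : ∀ t : ℝ, 0 < (1 + |t|) ^ (-2 : ℝ) := fun t => by positivity
  have hone : ∀ t : ℝ, (1 + |t|) ^ (-2 : ℝ) ≤ 1 := fun t =>
    Real.rpow_le_one_of_one_le_of_nonpos (by linarith [abs_nonneg t]) (by norm_num)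
  have hK0 : 0 ≤ K := by
    have := (norm_nonneg _).trans (hAK (a : ℂ) (by simpa using haa))
    exact nonneg_of_mul_nonneg_left this (hpos _)
  have hdE : ∀ (z : ℂ) (p q : ℝ), (∀ u ∈ Set.Icc p q, z.re + u ∈ Set.Icc (a + b) (a' + b')) →
      DifferentiableOn ℂ (fun u => E (z + u)) (re ⁻¹' Set.Icc p q) := by
    intro z p q h
    exact hE.comp (by fun_prop) fun u hu => by simpa using h u.re hu
  have shift_inner : (VI a fun s => VI b fun u => A s * A u * E (s + u)) =
      VI a fun s => VI b' fun u => A s * A u * E (s + u) := by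
    refine VI_congr_ae (Eventually.of_forall fun t => ?_)
    refine VI_eq_of_differentiableOn (K := K * K * L) hbb ?_ fun u h1 h2 => ?_
    · refine ((differentiableOn_const _).mul hB).mul (hdE _ _ _ fun u hu => ?_)
      simp only [add_re, ofReal_re, mul_re, I_re, mul_zero, ofReal_im, I_im, mul_one, sub_self,
          add_zero]
      exact ⟨by linarith [hu.1], by linarith [hu.2]⟩
    · have b1 : ‖A (a + t * I)‖ ≤ K := by
        refine (hAK (a + t * I) (by simpa using haa)).trans ?_
        exact mul_le_of_le_one_right hK0 (hone _)
      have b2 := hBK u ⟨h1, h2⟩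
      have b3 := hEL (a + t * I + u) (by
        simp
        exact ⟨by linarith, by linarith⟩)
      rw [norm_mul, norm_mul]
      calc _ ≤ K * (K * (1 + |u.im|) ^ (-2 : ℝ)) * L := by gcongr
        _ = _ := by ring
  have swap : (VI a fun s => VI b' fun u => A s * A u * E (s + u)) =
      VI b' fun u => VI a fun s => A s * A u * E (s + u) := by
    refine VI_comm (F := fun s u => A s * A u * E (s + u)) ?_
    refine MeasureTheory.Integrable.mono' (g := fun z : ℝ × ℝ =>
      K * (1 + |z.1|) ^ (-2 : ℝ) * (K * (1 + |z.2|) ^ (-2 : ℝ)) * L) ?_ ?_ ?_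
    · exact ((integrable_one_add_abs_rpow.const_mul K).mul_prod
        (integrable_one_add_abs_rpow.const_mul K)).mul_const L
    · refine Continuous.aestronglyMeasurable ?_
      refine ((hA.continuousOn.comp_continuous (by fun_prop) fun z => ?_).mul
        (hB.continuousOn.comp_continuous (by fun_prop) fun z => ?_)).mul
        (hE.continuousOn.comp_continuous (by fun_prop) fun z => ?_)
      · simpa using haa
      · simpa using hbb
      · constructor <;> simp <;> linarith
    · refine Eventually.of_forall fun z => ?_
      have b1 := hAK (a + z.1 * I) (by simpa using haa)
      have b2 := hBK (b' + z.2 * I) (by simpa using hbb)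
      have b3 := hEL (a + z.1 * I + (b' + z.2 * I)) (by
        constructor <;> simp <;> linarith)
      rw [norm_mul, norm_mul]
      simp only [add_im, ofReal_im, mul_im, ofReal_re, I_im, mul_one, I_re, mul_zero, add_zero,
        zero_add] at b1 b2
      gcongr
  rw [shift_inner, swap]
  refine VI_congr_ae (Eventually.of_forall fun t => ?_)
  have e : (fun s => A s * A (b' + t * I) * E (s + (b' + t * I))) =
      fun s => A (b' + t * I) * A s * E (b' + t * I + s) := by
    funext s
    rw [add_comm s, mul_comm (A s)]
  simp only [e]
  refine VI_eq_of_differentiableOn (K := K * K * L) haa ?_ fun u h1 h2 => ?_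
  · refine ((differentiableOn_const _).mul hA).mul (hdE _ _ _ fun u hu => ?_)
    simp only [add_re, ofReal_re, mul_re, I_re, mul_zero, ofReal_im, I_im, mul_one, sub_self,
          add_zero]
    exact ⟨by linarith [hu.1], by linarith [hu.2]⟩
  · have b1 : ‖A (b' + t * I)‖ ≤ K := by
      refine (hBK (b' + t * I) (by simpa using hbb)).trans ?_
      exact mul_le_of_le_one_right hK0 (hone _)
    have b2 := hAK u ⟨h1, h2⟩
    have b3 := hEL (b' + t * I + u) (by
      simp
      exact ⟨by linarith, by linarith⟩)
    rw [norm_mul, norm_mul]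
    calc _ ≤ K * (K * (1 + |u.im|) ^ (-2 : ℝ)) * L := by gcongr
      _ = _ := by ring

end VerticalIntegrals

section Zeros

theorem eventually_nhdsNE_ne_zero {f : ℂ → ℂ} (hf : Differentiable ℂ f) {z₀ : ℂ}
    (h : f z₀ ≠ 0) (z : ℂ) : ∀ᶠ w in nhdsWithin z {z}ᶜ, f w ≠ 0 := by
  have h1 : AnalyticOnNhd ℂ f Set.univ := fun z _ => hf.analyticAt z
  have := h1.preimage_zero_mem_codiscrete h
  rw [mem_codiscrete] at this
  have h2 := this z
  rw [disjoint_principal_right, compl_compl] at h2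
  filter_upwards [h2] with w hw using hw

theorem countable_setOf_eq_zero {f : ℂ → ℂ} (hf : Differentiable ℂ f) {z₀ : ℂ}
    (h : f z₀ ≠ 0) : {z | f z = 0}.Countable := by
  have h1 : AnalyticOnNhd ℂ f Set.univ := fun z _ => hf.analyticAt z
  have h2 := mem_codiscrete'.mp (h1.preimage_zero_mem_codiscrete h)
  have h3 : (f ⁻¹' {0}ᶜ)ᶜ = {z | f z = 0} := by ext; simp
  rw [← h3]
  exact h2.1.isClosed_compl.isLindelof.countable_of_isDiscrete h2.2

theorem ae_vertical_ne_zero {f : ℂ → ℂ} (hf : Differentiable ℂ f) {z₀ : ℂ} (h : f z₀ ≠ 0)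
    (c : ℂ) {u : ℂ} (hu : u ≠ 0) : ∀ᵐ t : ℝ, f (c + t * u) ≠ 0 := by
  rw [MeasureTheory.ae_iff]
  refine Set.Countable.measure_zero ?_ _
  simp only [not_not]
  refine (countable_setOf_eq_zero hf h).preimage_of_injOn
    (f := fun t : ℝ => c + t * u) fun s _ t _ hst => ?_
  simpa [hu] using hst

/-- A quotient of entire functions either is holomorphic on a given set or has a pole in it. -/
theorem exists_differentiableOn_mul_eq_or_exists_isBigO {q f : ℂ → ℂ} (hq : Differentiable ℂ q)
    (hf : Differentiable ℂ f) {z₀ : ℂ} (h : f z₀ ≠ 0) (V : Set ℂ) :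
    (∃ g : ℂ → ℂ, DifferentiableOn ℂ g V ∧ ∀ z ∈ V, g z * f z = q z) ∨
      ∃ ρ ∈ V, f ρ = 0 ∧
        (fun z => (z - ρ)⁻¹) =O[nhdsWithin ρ {ρ}ᶜ] fun z => q z / f z := by
  have hm : ∀ z, MeromorphicAt (fun z => q z / f z) z := fun z =>
    (hq.analyticAt z).meromorphicAt.fun_div (hf.analyticAt z).meromorphicAt
  have hmV : MeromorphicOn (fun z => q z / f z) V := fun z _ => hm z
  by_cases hV : ∀ z ∈ V, 0 ≤ meromorphicOrderAt (fun z => q z / f z) z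
  · left
    have han : ∀ z ∈ V, AnalyticAt ℂ (toMeromorphicNFOn (fun z => q z / f z) V) z := by
      intro z hz
      rw [← ((meromorphicNFOn_toMeromorphicNFOn (fun z => q z / f z) V)
        hz).meromorphicOrderAt_nonneg_iff_analyticAt, meromorphicOrderAt_toMeromorphicNFOn hmV hz]
      exact hV z hz
    refine ⟨toMeromorphicNFOn (fun z => q z / f z) V,
      fun z hz => (han z hz).differentiableAt.differentiableWithinAt, fun z hz => ?_⟩
    have h1 : (fun w => toMeromorphicNFOn (fun z => q z / f z) V w * f w)
        =ᶠ[nhdsWithin z {z}ᶜ] q := by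
      filter_upwards [hmV.toMeromorphicNFOn_eq_self_on_nhdsNE hz,
        eventually_nhdsNE_ne_zero hf h z] with w hw1 hw2
      rw [hw1, div_mul_cancel₀ _ hw2]
    have h2 : ContinuousAt (fun w => toMeromorphicNFOn (fun z => q z / f z) V w * f w) z :=
      (han z hz).continuousAt.mul (hf z).continuousAt
    exact tendsto_nhds_unique ((h2.tendsto.mono_left nhdsWithin_le_nhds).congr' h1)
      ((hq z).continuousAt.tendsto.mono_left nhdsWithin_le_nhds)
  · right
    push Not at hV
    obtain ⟨ρ, hρ, hord⟩ := hV
    refine ⟨ρ, hρ, ?_, ?_⟩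
    · by_contra hfρ
      have han : AnalyticAt ℂ (fun z => q z / f z) ρ :=
        (hq.analyticAt ρ).fun_div (hf.analyticAt ρ) hfρ
      exact absurd han.meromorphicOrderAt_nonneg hord.not_ge
    · obtain ⟨n, hn⟩ := WithTop.ne_top_iff_exists.mp (ne_top_of_lt hord)
      rw [← hn] at hord
      have hn0 : n < 0 := by exact_mod_cast hord
      obtain ⟨k, hk, hkρ, hkz⟩ := (meromorphicOrderAt_eq_int_iff (hm ρ)).mp hn.symm
      have hkpos : 0 < ‖k ρ‖ := norm_pos_iff.mpr hkρ
      refine Asymptotics.IsBigO.of_bound (2 / ‖k ρ‖) ?_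
      have h1 : ∀ᶠ z in nhds ρ, ‖k ρ‖ / 2 < ‖k z‖ :=
        hk.continuousAt.norm.eventually (lt_mem_nhds (by linarith))
      have h2 : ∀ᶠ z in nhds ρ, z ∈ Metric.ball ρ 1 := Metric.ball_mem_nhds ρ one_pos
      filter_upwards [hkz, nhdsWithin_le_nhds h1, nhdsWithin_le_nhds h2, self_mem_nhdsWithin]
        with z hz1 hz2 hz3 hz4
      have hz0 : 0 < ‖z - ρ‖ := norm_pos_iff.mpr (sub_ne_zero.mpr hz4)
      have hz5 : ‖z - ρ‖ < 1 := by simpa [dist_eq_norm] using hz3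
      have hz6 : ‖z - ρ‖⁻¹ ≤ ‖z - ρ‖ ^ n := by
        rw [← zpow_neg_one]
        exact zpow_le_zpow_right_of_le_one₀ hz0 hz5.le (by omega)
      rw [hz1, norm_smul, norm_zpow, norm_inv, div_mul_eq_mul_div, le_div_iff₀ hkpos]
      have hz7 : 0 ≤ ‖z - ρ‖⁻¹ := inv_nonneg.mpr hz0.le
      nlinarith

theorem riemannZeta₁_eq_sub_mul {s : ℂ} (hs : s ≠ 1) :
    riemannZeta₁ s = (s - 1) * riemannZeta s := by
  rw [riemannZeta_eq_inv_sub_mul hs, mul_inv_cancel_left₀ (sub_ne_zero.mpr hs)]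

theorem RiemannHypothesis.re_eq_half_of_riemannZeta₁_eq_zero (hRH : RiemannHypothesis) {s : ℂ}
    (h0 : -2 < s.re) (h : riemannZeta₁ s = 0) : s.re = 1 / 2 := by
  have h1 : s ≠ 1 := by
    rintro rfl
    simp at h
  refine hRH s ?_ ?_ h1
  · rw [riemannZeta_eq_inv_sub_mul h1, h, mul_zero]
  · rintro ⟨n, rfl⟩
    have : (0 : ℝ) ≤ n := n.cast_nonneg
    simp at h0
    linarith

theorem RiemannHypothesis.riemannZeta₁_ne_zero (hRH : RiemannHypothesis) {s : ℂ}
    (h0 : -2 < s.re) (h : s.re ≠ 1 / 2) : riemannZeta₁ s ≠ 0 :=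
  fun hs => h (hRH.re_eq_half_of_riemannZeta₁_eq_zero h0 hs)

end Zeros

section Factors

/-- The quotient `Ŵ(w - 1) / ζ(w)`, written with the entire function `riemannZeta₁`. -/
noncomputable def mellinQuot (φ : ℝ → ℝ) (w : ℂ) : ℂ :=
  (w - 1) * mellinW φ (w - 1) / riemannZeta₁ w

/-- The factor of the integrand depending on a single variable. -/
noncomputable def singleFactor (φ : ℝ → ℝ) (s : ℂ) : ℂ :=
  riemannZeta (2 - s) * mellinW φ s / riemannZeta s

/-- The factor of the integrand depending on the sum of the variables, without the powers. -/
noncomputable def coupledFactor (φ : ℝ → ℝ) (s : ℂ) : ℂ :=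
  riemannZeta₁ (3 - s) / (2 - s) * mellinQuot φ (4 - s)

theorem exists_norm_mul_le {f g : ℂ → ℂ} {S : Set ℂ} {M N : ℝ}
    (hf : ∃ K, ∀ w ∈ S, ‖f w‖ ≤ K * (1 + |w.im|) ^ M)
    (hg : ∃ K, ∀ w ∈ S, ‖g w‖ ≤ K * (1 + |w.im|) ^ N) :
    ∃ K, ∀ w ∈ S, ‖f w * g w‖ ≤ K * (1 + |w.im|) ^ (M + N) := by
  obtain ⟨K, hK⟩ := hf
  obtain ⟨L, hL⟩ := hg
  refine ⟨K * L, fun w hw => ?_⟩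
  rw [norm_mul, Real.rpow_add (by positivity)]
  calc _ ≤ (K * (1 + |w.im|) ^ M) * (L * (1 + |w.im|) ^ N) :=
        mul_le_mul (hK w hw) (hL w hw) (norm_nonneg _) ((norm_nonneg _).trans (hK w hw))
    _ = _ := by ring

theorem exists_norm_riemannZeta₁_le_rpow :
    ∃ C, ∀ s ∈ re ⁻¹' Set.Icc (-1) 4, ‖riemannZeta₁ s‖ ≤ C * (1 + |s.im|) ^ (4 : ℝ) := by
  obtain ⟨C, -, h⟩ := exists_norm_riemannZeta₁_le
  refine ⟨C, fun s hs => ?_⟩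
  have := h s hs.1 hs.2
  exact_mod_cast this

variable {p q : ℝ} {φ : ℝ → ℝ}

theorem exists_norm_sub_one_mul_mellinW_le (hp : 0 < p) (hpq : p ≤ q)
    (hs : ContDiff ℝ (⊤ : ℕ∞) φ) (hφ : ∀ t ∉ Set.Icc p q, φ t = 0) (N : ℝ) :
    ∃ K, ∀ w ∈ re ⁻¹' Set.Icc 0 4, ‖(w - 1) * mellinW φ (w - 1)‖ ≤ K * (1 + |w.im|) ^ N := by
  have := exists_norm_mul_le (f := fun w => w - 1) (g := fun w => mellinW φ (w - 1))
    (S := re ⁻¹' Set.Icc 0 4) (M := 1) (N := N - 1) ?_ ?_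
  · simpa using this
  · refine ⟨3, fun w hw => ?_⟩
    have := norm_le_abs_re_add_abs_im_le (s := w - 1) (a := 3) (by norm_num)
      (by simp only [sub_re, one_re]; exact abs_le.mpr ⟨by linarith [hw.1], by linarith [hw.2]⟩)
    simpa using this
  · obtain ⟨C, -, hC⟩ := exists_norm_mellinW_le_rpow hp hpq hs hφ (-1) 3 (N - 1)
    refine ⟨C, fun w hw => ?_⟩
    have := hC (w - 1) (by simpa using hw.1) (by simp; linarith [hw.2])
    simpa using this

theorem exists_norm_mellinQuot_le (hp : 0 < p) (hpq : p ≤ q)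
    (hs : ContDiff ℝ (⊤ : ℕ∞) φ) (hφ : ∀ t ∉ Set.Icc p q, φ t = 0) {a b : ℝ} (ha : 0 < a)
    (hab : a < b) (hb : b < 2) {h : ℂ → ℂ} (hh : DifferentiableOn ℂ h {w | a < w.re})
    (hmul : ∀ w : ℂ, a < w.re → h w * riemannZeta₁ w = (w - 1) * mellinW φ (w - 1)) :
    ∃ K, ∀ w ∈ re ⁻¹' Set.Icc b 2, ‖mellinQuot φ w‖ ≤ K * (1 + |w.im|) ^ (-4 : ℝ) := by
  obtain ⟨A, hA⟩ := exists_norm_le_of_norm_mul_riemannZeta₁_le ha hab hb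
  obtain ⟨K, hK⟩ := exists_norm_sub_one_mul_mellinW_le hp hpq hs hφ (-4 - A)
  obtain ⟨K', hK'⟩ := hA h (-4 - A) K hh fun w h1 h2 => by
    rw [hmul w h1]
    exact hK w ⟨by linarith, h2⟩
  refine ⟨K', fun w hw => ?_⟩
  have h1 := hK' w hw.1 hw.2
  rw [sub_add_cancel] at h1
  refine le_trans ?_ h1
  rw [mellinQuot, ← hmul w (hab.trans_le hw.1)]
  by_cases hw0 : riemannZeta₁ w = 0
  · simp [hw0]
  · rw [mul_div_cancel_right₀ _ hw0]

theorem differentiable_sub_one_mul_mellinW (hp : 0 < p) (hs : Continuous φ)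
    (hφ : ∀ t ∉ Set.Icc p q, φ t = 0) :
    Differentiable ℂ fun w => (w - 1) * mellinW φ (w - 1) := by
  have := (differentiable_mellinW hp hs hφ).comp (g := mellinW φ)
    (f := fun w : ℂ => w - 1) (by fun_prop)
  exact (differentiable_id.sub_const 1).mul this

theorem RiemannHypothesis.differentiableAt_mellinQuot (hRH : RiemannHypothesis) (hp : 0 < p)
    (hs : Continuous φ) (hφ : ∀ t ∉ Set.Icc p q, φ t = 0) {w : ℂ} (hw : 1 / 2 < w.re) :
    DifferentiableAt ℂ (mellinQuot φ) w :=
  ((differentiable_sub_one_mul_mellinW hp hs hφ) w).fun_div (differentiable_riemannZeta₁ w)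
    (hRH.riemannZeta₁_ne_zero (by linarith) hw.ne')

theorem RiemannHypothesis.exists_norm_mellinQuot_le_of_half_lt (hRH : RiemannHypothesis)
    (hp : 0 < p) (hpq : p ≤ q) (hs : ContDiff ℝ (⊤ : ℕ∞) φ)
    (hφ : ∀ t ∉ Set.Icc p q, φ t = 0) {b : ℝ} (hb : 1 / 2 < b) (hb' : b < 2) :
    ∃ K, ∀ w ∈ re ⁻¹' Set.Icc b 2, ‖mellinQuot φ w‖ ≤ K * (1 + |w.im|) ^ (-4 : ℝ) :=
  exists_norm_mellinQuot_le hp hpq hs hφ one_half_pos hb hb'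
    (fun _ hw => (hRH.differentiableAt_mellinQuot hp hs.continuous
      hφ hw).differentiableWithinAt)
    fun _ hw => div_mul_cancel₀ _ (hRH.riemannZeta₁_ne_zero (by linarith) hw.ne')

theorem RiemannHypothesis.exists_norm_mellinQuot_le_of_lt_half (hRH : RiemannHypothesis)
    (hp : 0 < p) (hpq : p ≤ q) (hs : ContDiff ℝ (⊤ : ℕ∞) φ)
    (hφ : ∀ t ∉ Set.Icc p q, φ t = 0) {σ : ℝ} (h0 : 0 < σ) (h1 : σ < 1 / 2) :
    ∃ K, ∀ w ∈ re ⁻¹' Set.Icc σ σ, ‖mellinQuot φ w‖ ≤ K * (1 + |w.im|) ^ (-4 : ℝ) := by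
  obtain ⟨A, hA⟩ := exists_norm_le_of_norm_mul_riemannZeta₁_le (a := 1 / 2) (b := 1 - σ)
    one_half_pos (by linarith) (by linarith)
  have hne : ∀ w : ℂ, 1 / 2 < w.re → riemannZeta₁ w ≠ 0 := fun w hw =>
    hRH.riemannZeta₁_ne_zero (by linarith) hw.ne'
  obtain ⟨K, hK⟩ := hA (fun w => (riemannZeta₁ w)⁻¹) 0 1
    (fun w hw => (differentiable_riemannZeta₁ w).fun_inv (hne w hw) |>.differentiableWithinAt)
    fun w hw _ => by simp [inv_mul_cancel₀ (hne w hw)]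
  rw [zero_add] at hK
  obtain ⟨C, hC, hCb⟩ := exists_norm_inv_riemannZeta_le_of_lt_half h0 h1
  have key : ∃ L, ∀ w ∈ re ⁻¹' Set.Icc σ σ,
      ‖(riemannZeta₁ w)⁻¹‖ ≤ L * (1 + |w.im|) ^ (A + 1) := by
    refine ⟨2 * C * K, fun w hw => ?_⟩
    have hre : w.re = σ := le_antisymm hw.2 hw.1
    have hw0 : w ≠ 0 := by rintro rfl; simp at hre; linarith
    have hw1 : w ≠ 1 := by rintro rfl; simp at hre; linarith
    have e1 : (riemannZeta₁ w)⁻¹ = (w - 1)⁻¹ * (riemannZeta w)⁻¹ := by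
      rw [riemannZeta₁_eq_sub_mul hw1, mul_inv]
    have e2 : (riemannZeta (1 - w))⁻¹ = (-w) * (riemannZeta₁ (1 - w))⁻¹ := by
      rw [riemannZeta₁_eq_sub_mul (by simpa using hw0), mul_inv, ← mul_assoc,
        show 1 - w - 1 = -w by ring, mul_inv_cancel₀ (neg_ne_zero.mpr hw0), one_mul]
    have e3 : w = σ + w.im * I := by rw [← hre, re_add_im]
    have b1 : ‖(riemannZeta w)⁻¹‖ ≤ C * ‖(riemannZeta (1 - w))⁻¹‖ := by
      have := hCb w.im
      rwa [← e3] at this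
    have b2 := hK (1 - w) (by simp [hre]) (by simp [hre]; linarith)
    simp only [sub_im, one_im, zero_sub, abs_neg] at b2
    have b3 : ‖w‖ ≤ 1 * (1 + |w.im|) := norm_le_abs_re_add_abs_im_le le_rfl
      (by rw [hre]; exact abs_le.mpr ⟨by linarith, by linarith⟩)
    have b4 : ‖(w - 1)⁻¹‖ ≤ 2 := by
      rw [norm_inv]
      refine inv_le_of_inv_le₀ two_pos (le_trans ?_ (abs_re_le_norm (w - 1)))
      simp only [sub_re, one_re, hre]
      rw [abs_of_nonpos (by linarith)]
      linarith
    rw [e2, norm_mul, norm_neg] at b1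
    rw [e1, norm_mul, Real.rpow_add (by positivity), Real.rpow_one]
    calc _ ≤ 2 * (C * (1 * (1 + |w.im|) * (K * (1 + |w.im|) ^ A))) := by
          gcongr
          exact b1.trans (by gcongr)
      _ = _ := by ring
  have := exists_norm_mul_le (S := re ⁻¹' Set.Icc σ σ)
    (f := fun w => (w - 1) * mellinW φ (w - 1)) (M := -4 - (A + 1)) (by
      obtain ⟨K, hK⟩ := exists_norm_sub_one_mul_mellinW_le hp hpq hs hφ (-4 - (A + 1))
      exact ⟨K, fun w hw => hK w ⟨by linarith [hw.1], by linarith [hw.2]⟩⟩) key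
  rw [sub_add_cancel] at this
  exact this

theorem exists_norm_coupledFactor_le {b b' : ℝ} (hb : 0 < b) (hb' : b' < 2)
    (h : ∃ K, ∀ w ∈ re ⁻¹' Set.Icc b b', ‖mellinQuot φ w‖ ≤ K * (1 + |w.im|) ^ (-4 : ℝ)) :
    ∃ K, ∀ s : ℂ, 4 - s.re ∈ Set.Icc b b' → ‖coupledFactor φ s‖ ≤ K := by
  obtain ⟨C, hC⟩ := exists_norm_riemannZeta₁_le_rpow
  obtain ⟨K, hK⟩ := exists_norm_mul_le (S := re ⁻¹' Set.Icc b b')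
    (f := fun w => riemannZeta₁ (w - 1)) ⟨C, fun w hw => by
      have := hC (w - 1) ⟨by simp; linarith [hw.1], by simp; linarith [hw.2]⟩
      simpa only [sub_im, one_im, sub_zero] using this⟩ h
  refine ⟨K * (2 - b')⁻¹, fun s hs => ?_⟩
  have h1 := hK (4 - s) (by simpa using hs)
  norm_num at h1
  have h2 : ‖(2 - s)⁻¹‖ ≤ (2 - b')⁻¹ := by
    rw [norm_inv]
    refine inv_anti₀ (by linarith) (le_trans ?_ (abs_re_le_norm (2 - s)))
    rw [abs_of_nonpos (by simp; linarith [hs.2])]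
    simp
    linarith [hs.2]
  have h3 : coupledFactor φ s = riemannZeta₁ (4 - s - 1) * mellinQuot φ (4 - s) * (2 - s)⁻¹ := by
    rw [coupledFactor, show (4 - s - 1 : ℂ) = 3 - s by ring]
    ring
  have h4 : ‖riemannZeta₁ (4 - s - 1) * mellinQuot φ (4 - s)‖ ≤ K := by
    rw [norm_mul]; exact h1
  rw [h3, norm_mul]
  exact mul_le_mul h4 h2 (norm_nonneg _) ((norm_nonneg _).trans h4)

theorem exists_norm_singleFactor_le (hp : 0 < p) (hpq : p ≤ q)
    (hs : ContDiff ℝ (⊤ : ℕ∞) φ) (hφ : ∀ t ∉ Set.Icc p q, φ t = 0) {a b : ℝ} (ha : 1 < a)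
    (hb : b < 2) :
    ∃ K, ∀ s : ℂ, s.re ∈ Set.Icc a b → ‖singleFactor φ s‖ ≤ K * (1 + |s.im|) ^ (-2 : ℝ) := by
  obtain ⟨C, hC⟩ := exists_norm_riemannZeta₁_le_rpow
  obtain ⟨D, hD, hDb⟩ := exists_norm_inv_riemannZeta_le ha
  obtain ⟨K, hK⟩ := exists_norm_mul_le (S := re ⁻¹' Set.Icc a b)
    (f := fun s => riemannZeta₁ (2 - s)) (g := mellinW φ) (M := 4) (N := -6) ⟨C, fun w hw => by
      have := hC (2 - w) ⟨by simp; linarith [hw.2], by simp; linarith [hw.1]⟩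
      simpa only [sub_im, im_ofNat, zero_sub, abs_neg] using this⟩ (by
      obtain ⟨K, -, hK⟩ := exists_norm_mellinW_le_rpow hp hpq hs hφ a b (-6)
      exact ⟨K, fun w hw => hK w hw.1 hw.2⟩)
  refine ⟨(a - 1)⁻¹ * D * K, fun s hs => ?_⟩
  have h1 := hK s hs
  norm_num only [] at h1
  have h2 := hDb s hs.1
  have hs1 : s ≠ 1 := by
    rintro rfl
    have := hs.1
    simp at this
    linarith
  have h3 : singleFactor φ s = (1 - s)⁻¹ * (riemannZeta s)⁻¹ *
      (riemannZeta₁ (2 - s) * mellinW φ s) := by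
    rw [singleFactor, riemannZeta_eq_inv_sub_mul (s := 2 - s)
      (fun h => hs1 (by linear_combination -h)), show (2 - s - 1 : ℂ) = 1 - s by ring]
    ring
  have h4 : ‖(1 - s)⁻¹‖ ≤ (a - 1)⁻¹ := by
    rw [norm_inv]
    refine inv_anti₀ (by linarith) (le_trans ?_ (abs_re_le_norm (1 - s)))
    rw [abs_of_nonpos (by simp; linarith [hs.1])]
    simp
    linarith [hs.1]
  have ha1 : 0 < (a - 1)⁻¹ := inv_pos.mpr (by linarith)
  rw [h3, norm_mul, norm_mul]
  calc _ ≤ (a - 1)⁻¹ * D * (K * (1 + |s.im|) ^ (-2 : ℝ)) :=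
        mul_le_mul (mul_le_mul h4 h2 (norm_nonneg _) ha1.le) h1 (norm_nonneg _) (by positivity)
    _ = _ := by ring

theorem differentiableAt_singleFactor (hp : 0 < p) (hs : Continuous φ)
    (hφ : ∀ t ∉ Set.Icc p q, φ t = 0) {s : ℂ} (h1 : 1 < s.re) :
    DifferentiableAt ℂ (singleFactor φ) s := by
  have hs1 : s ≠ 1 := by rintro rfl; simp at h1
  have hs2 : 2 - s ≠ 1 := fun h => hs1 (by linear_combination -h)
  have e1 : DifferentiableAt ℂ (fun s => riemannZeta (2 - s)) s :=
    (differentiableAt_riemannZeta hs2).comp s (by fun_prop)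
  exact (e1.mul (differentiable_mellinW hp hs hφ s)).fun_div (differentiableAt_riemannZeta hs1)
    (riemannZeta_ne_zero_of_one_lt_re h1)

theorem RiemannHypothesis.differentiableAt_coupledFactor (hRH : RiemannHypothesis) (hp : 0 < p)
    (hs : Continuous φ) (hφ : ∀ t ∉ Set.Icc p q, φ t = 0) {s : ℂ} (h1 : 2 < s.re)
    (h2 : s.re < 7 / 2) : DifferentiableAt ℂ (coupledFactor φ) s := by
  have hs2 : 2 - s ≠ 0 := by
    intro h
    rw [sub_eq_zero] at h
    simp [← h] at h1
  have e1 : DifferentiableAt ℂ (fun s => riemannZeta₁ (3 - s)) s :=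
    (differentiable_riemannZeta₁ (3 - s)).comp s (by fun_prop)
  have e2 : DifferentiableAt ℂ (fun s => mellinQuot φ (4 - s)) s :=
    (hRH.differentiableAt_mellinQuot hp hs hφ (w := 4 - s) (by simp; linarith)).comp s
      (by fun_prop)
  exact (e1.fun_div (by fun_prop) hs2).mul e2

end Factors

section Assembly

theorem singleFactor_mul_singleFactor_mul {φ : ℝ → ℝ} {x y : ℝ} {s u : ℂ}
    (h2 : s + u ≠ 2) (h3 : s + u ≠ 3) :
    riemannZeta (3 - s - u) * riemannZeta (2 - s) * riemannZeta (2 - u) /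
        (riemannZeta (4 - (s + u)) * riemannZeta s * riemannZeta u) *
        (y : ℂ) ^ (3 - s - u) * (x : ℂ) ^ (s + u) *
        mellinW φ (3 - s - u) * mellinW φ s * mellinW φ u =
      singleFactor φ s * singleFactor φ u *
        (coupledFactor φ (s + u) * ((x : ℂ) ^ (s + u) * (y : ℂ) ^ (3 - (s + u)))) := by
  have e3 : 3 - (s + u) ≠ 0 := fun h => h3 (by linear_combination -h)
  have e1 : riemannZeta₁ (3 - (s + u)) = (2 - (s + u)) * riemannZeta (3 - (s + u)) := by
    rw [riemannZeta₁_eq_sub_mul (fun h => h2 (by linear_combination -h))]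
    ring
  have e2 : riemannZeta₁ (4 - (s + u)) = (3 - (s + u)) * riemannZeta (4 - (s + u)) := by
    rw [riemannZeta₁_eq_sub_mul (fun h => h3 (by linear_combination -h))]
    ring
  rw [coupledFactor, mellinQuot, e1, e2, sub_sub 3 s u,
    mul_div_cancel_left₀ _ (fun h => h2 (by linear_combination -h)),
    show (4 - (s + u) - 1 : ℂ) = 3 - (s + u) by ring, mul_div_mul_left _ _ e3]
  simp only [singleFactor, div_eq_mul_inv, mul_inv]
  ring

theorem norm_cpow_mul_cpow {x y : ℝ} (hx : 0 < x) (hy : 0 < y) (s : ℂ) :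
    ‖(x : ℂ) ^ s * (y : ℂ) ^ (3 - s)‖ = x ^ s.re * y ^ (3 - s.re) := by
  rw [norm_mul, norm_cpow_eq_rpow_re_of_pos hx, norm_cpow_eq_rpow_re_of_pos hy]
  simp

theorem ae_add_mul_I_ne (z w : ℂ) : ∀ᵐ t : ℝ, z + t * I ≠ w := by
  have := ae_vertical_ne_zero (f := fun s => s - w) (by fun_prop) (z₀ := w + 1) (by simp) z
    I_ne_zero
  simpa only [sub_ne_zero] using this

variable {p q : ℝ} {φ : ℝ → ℝ}

theorem VI_VI_eq_factors {x y a b : ℝ} :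
    (VI a fun s => VI b fun u => riemannZeta (3 - s - u) * riemannZeta (2 - s) *
        riemannZeta (2 - u) / (riemannZeta (4 - (s + u)) * riemannZeta s * riemannZeta u) *
        (y : ℂ) ^ (3 - s - u) * (x : ℂ) ^ (s + u) *
        mellinW φ (3 - s - u) * mellinW φ s * mellinW φ u) =
      VI a fun s => VI b fun u => singleFactor φ s * singleFactor φ u *
        (coupledFactor φ (s + u) * ((x : ℂ) ^ (s + u) * (y : ℂ) ^ (3 - (s + u)))) := by
  congr 1
  ext s
  refine VI_congr_ae ?_
  filter_upwards [ae_add_mul_I_ne (s + b) 2, ae_add_mul_I_ne (s + b) 3] with t h2 h3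
  rw [add_assoc] at h2 h3
  exact singleFactor_mul_singleFactor_mul h2 h3

theorem exists_norm_VI_VI_factors_le (hp : 0 < p) (hpq : p ≤ q)
    (hs : ContDiff ℝ (⊤ : ℕ∞) φ) (hφ : ∀ t ∉ Set.Icc p q, φ t = 0) {a b K : ℝ} (ha : 1 < a)
    (ha' : a < 2) (hb : 1 < b) (hb' : b < 2)
    (hK : ∀ s : ℂ, s.re = a + b → ‖coupledFactor φ s‖ ≤ K) :
    ∃ C, ∀ x y : ℝ, 0 < x → 0 < y →
      ‖VI a fun s => VI b fun u => singleFactor φ s * singleFactor φ u *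
        (coupledFactor φ (s + u) * ((x : ℂ) ^ (s + u) * (y : ℂ) ^ (3 - (s + u))))‖ ≤
        C * (x ^ (a + b) * y ^ (3 - (a + b))) := by
  obtain ⟨L, hL⟩ := exists_norm_singleFactor_le hp hpq hs hφ (lt_min ha hb) (max_lt ha' hb')
  refine ⟨(L * ∫ t : ℝ, (1 + |t|) ^ (-2 : ℝ)) ^ 2 * K, fun x y hx hy => ?_⟩
  rw [mul_assoc _ K]
  refine norm_VI_VI_mul_le (A := singleFactor φ)
    (E := fun s => coupledFactor φ s * ((x : ℂ) ^ s * (y : ℂ) ^ (3 - s))) (fun t => ?_) (fun t => ?_) fun t => ?_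
  · simpa using hL (a + t * I) (by simp)
  · simpa using hL (b + t * I) (by simp)
  · rw [norm_mul, norm_cpow_mul_cpow hx hy]
    have := hK ((a + b : ℝ) + t * I) (by simp)
    simp only [add_re, ofReal_re, mul_re, I_re, mul_zero, ofReal_im, I_im, mul_one, sub_self,
      add_zero]
    gcongr

theorem RiemannHypothesis.VI_VI_factors_eq (hRH : RiemannHypothesis) (hp : 0 < p) (hpq : p ≤ q)
    (hs : ContDiff ℝ (⊤ : ℕ∞) φ) (hφ : ∀ t ∉ Set.Icc p q, φ t = 0) {a b a' b' x y : ℝ}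
    (ha : 1 < a) (haa : a ≤ a') (ha' : a' < 2) (hb : 1 < b) (hbb : b ≤ b') (hb' : b' < 2)
    (hab : a' + b' < 7 / 2) (hx : 0 < x) (hy : 0 < y) :
    (VI a fun s => VI b fun u => singleFactor φ s * singleFactor φ u *
        (coupledFactor φ (s + u) * ((x : ℂ) ^ (s + u) * (y : ℂ) ^ (3 - (s + u))))) =
      VI b' fun s => VI a' fun u => singleFactor φ s * singleFactor φ u *
        (coupledFactor φ (s + u) * ((x : ℂ) ^ (s + u) * (y : ℂ) ^ (3 - (s + u)))) := by
  obtain ⟨L, hL⟩ := exists_norm_singleFactor_le hp hpq hs hφ (lt_min ha hb) (max_lt ha' hb')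
  obtain ⟨M, hM⟩ := hRH.exists_norm_mellinQuot_le_of_half_lt hp hpq hs hφ
    (b := 4 - (a' + b')) (by linarith) (by linarith)
  obtain ⟨K, hK⟩ := exists_norm_coupledFactor_le (φ := φ) (b := 4 - (a' + b'))
    (b' := 4 - (a + b)) (by linarith) (by linarith)
    ⟨M, fun w hw => hM w ⟨hw.1, by linarith [hw.2]⟩⟩
  obtain ⟨B, hB⟩ := (isCompact_Icc (a := a + b) (b := a' + b')).exists_bound_of_continuousOn
    (f := fun σ : ℝ => x ^ σ * y ^ (3 - σ)) (by
      refine Continuous.continuousOn ?_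
      exact (Real.continuous_const_rpow hx.ne').mul
        ((Real.continuous_const_rpow hy.ne').comp (by fun_prop)))
  have hd : ∀ s : ℂ, 1 < s.re → DifferentiableAt ℂ (singleFactor φ) s := fun s h =>
    differentiableAt_singleFactor hp hs.continuous hφ h
  refine VI_VI_mul_eq (A := singleFactor φ)
    (E := fun s => coupledFactor φ s * ((x : ℂ) ^ s * (y : ℂ) ^ (3 - s))) (K := L) (L := K * B) haa hbb
    (fun s h => (hd s (ha.trans_le h.1)).differentiableWithinAt)
    (fun s h => (hd s (hb.trans_le h.1)).differentiableWithinAt) (fun s h => ?_)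
    (fun s h => hL s ⟨(min_le_left _ _).trans h.1, h.2.trans (le_max_left _ _)⟩)
    (fun s h => hL s ⟨(min_le_right _ _).trans h.1, h.2.trans (le_max_right _ _)⟩)
    fun s h => ?_
  · have h1 := h.1
    have h2 := h.2
    refine DifferentiableAt.differentiableWithinAt ?_
    refine (hRH.differentiableAt_coupledFactor hp hs.continuous hφ (by linarith)
      (by linarith)).mul (DifferentiableAt.mul ?_ ?_)
    · exact differentiableAt_id.const_cpow (Or.inl (by exact_mod_cast hx.ne'))
    · exact (differentiableAt_id.const_sub _).const_cpow (Or.inl (by exact_mod_cast hy.ne'))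
  · have hKs := hK s ⟨by linarith [h.2], by linarith [h.1]⟩
    rw [norm_mul, norm_cpow_mul_cpow hx hy]
    refine mul_le_mul hKs ((le_abs_self _).trans (hB s.re h)) (by positivity)
      ((norm_nonneg _).trans hKs)

theorem RiemannHypothesis.VI_VI_factors_eq_zero (hRH : RiemannHypothesis) (hp : 0 < p)
    (hs : Continuous φ) (hφ : ∀ t ∉ Set.Icc p q, φ t = 0) {a b x y : ℝ}
    (ha : a < 2) (hb : b < 2) (hab : a + b = 7 / 2) (hx : 0 < x) (hy : 0 < y)
    {ρ : ℂ} (hρ : ρ.re = 1 / 2)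
    (hO : (fun z => (z - ρ)⁻¹) =O[nhdsWithin ρ {ρ}ᶜ] mellinQuot φ) :
    (VI a fun s => VI b fun u => singleFactor φ s * singleFactor φ u *
        (coupledFactor φ (s + u) * ((x : ℂ) ^ (s + u) * (y : ℂ) ^ (3 - (s + u))))) = 0 := by
  have hM := differentiable_mellinW hp hs hφ
  obtain ⟨z₀, hz₀⟩ : ∃ z₀, mellinW φ z₀ ≠ 0 := by
    by_contra! h
    have h0 : mellinQuot φ = fun _ => 0 := by
      ext w
      simp [mellinQuot, h]
    rw [h0, Asymptotics.isBigO_zero_right_iff] at hO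
    obtain ⟨z, hz, hz'⟩ := (hO.and self_mem_nhdsWithin).exists
    exact hz' (by simpa [sub_eq_zero] using hz)
  have hne : ∀ s : ℂ, 3 / 2 < s.re → s.re < 2 → mellinW φ s ≠ 0 → singleFactor φ s ≠ 0 := by
    intro s hs1 hs2 hW
    have h1 : s ≠ 1 := by rintro rfl; norm_num at hs1
    have hz := hRH.riemannZeta₁_ne_zero (s := 2 - s) (by simp; linarith)
      (by simp; intro h; linarith)
    rw [riemannZeta₁_eq_sub_mul (fun h => h1 (by linear_combination -h))] at hz
    exact div_ne_zero (mul_ne_zero (right_ne_zero_of_mul hz) hW)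
      (riemannZeta_ne_zero_of_one_lt_re (by linarith))
  rw [← show VI a (fun _ => 0) = 0 by simp [VI]]
  refine VI_congr_ae ?_
  filter_upwards [ae_vertical_ne_zero hM hz₀ a I_ne_zero,
    ae_vertical_ne_zero hM hz₀ (4 - ρ - a) (neg_ne_zero.mpr I_ne_zero)] with t ht1 ht2
  set s : ℂ := a + t * I with hs_def
  have hsre : s.re = a := by simp [hs_def]
  set t₀ : ℝ := -ρ.im - t
  have hu₀ : (b : ℂ) + t₀ * I = 4 - ρ - s := by
    apply Complex.ext
    · simp [hs_def, hρ]; linarith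
    · simp [hs_def, t₀]
  have hF : ∀ u : ℂ, singleFactor φ s * singleFactor φ u *
      (coupledFactor φ (s + u) * ((x : ℂ) ^ (s + u) * (y : ℂ) ^ (3 - (s + u)))) =
      (singleFactor φ s * singleFactor φ u * (riemannZeta₁ (3 - (s + u)) / (2 - (s + u))) *
        ((x : ℂ) ^ (s + u) * (y : ℂ) ^ (3 - (s + u)))) * mellinQuot φ (4 - (s + u)) := by
    intro u
    rw [coupledFactor]
    ring
  simp only [hF]
  set H : ℂ → ℂ := fun u =>
    singleFactor φ s * singleFactor φ u * (riemannZeta₁ (3 - (s + u)) / (2 - (s + u))) *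
        ((x : ℂ) ^ (s + u) * (y : ℂ) ^ (3 - (s + u)))
  have hu₀re : (b + t₀ * I : ℂ).re = b := by simp
  have h2 : 2 - (s + (b + t₀ * I)) ≠ 0 := by
    intro h
    have := congrArg re h
    simp [hsre] at this
    linarith
  have hHc : ContinuousAt H (b + t₀ * I) := by
    have c1 : ContinuousAt (singleFactor φ) (b + t₀ * I) :=
      (differentiableAt_singleFactor hp hs hφ (by rw [hu₀re]; linarith)).continuousAt
    have c2 : Continuous fun u => riemannZeta₁ (3 - (s + u)) :=
      differentiable_riemannZeta₁.continuous.comp (by fun_prop)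
    have c3 : Continuous fun u : ℂ => (x : ℂ) ^ (s + u) :=
      (continuous_const.add continuous_id).const_cpow (Or.inl (by exact_mod_cast hx.ne'))
    have c4 : Continuous fun u : ℂ => (y : ℂ) ^ (3 - (s + u)) :=
      (continuous_const.sub (continuous_const.add continuous_id)).const_cpow
        (Or.inl (by exact_mod_cast hy.ne'))
    exact ((continuousAt_const.mul c1).mul (c2.continuousAt.div (by fun_prop) h2)).mul
      (c3.mul c4).continuousAt
  have hH0 : H (b + t₀ * I) ≠ 0 := by
    refine mul_ne_zero (mul_ne_zero (mul_ne_zero ?_ ?_) (div_ne_zero ?_ h2)) (mul_ne_zero ?_ ?_)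
    · exact hne s (by linarith) (by linarith) ht1
    · refine hne _ (by linarith) (by linarith) ?_
      rw [hu₀, hs_def]
      convert ht2 using 2
      ring
    · refine hRH.riemannZeta₁_ne_zero ?_ ?_ <;> simp [hsre] <;> linarith
    · simp [cpow_eq_zero_iff, hx.ne']
    · simp [cpow_eq_zero_iff, hy.ne']
  have hni : ¬ MeasureTheory.Integrable fun r : ℝ =>
      H (b + r * I) * mellinQuot φ (4 - (s + (b + r * I))) := by
    intro hint
    refine not_intervalIntegrable_of_sub_inv_isBigO_punctured (c := t₀) (a := t₀) (b := t₀ + 1)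
      ?_ (by simp) Set.left_mem_uIcc hint.intervalIntegrable
    have hz : ∀ r : ℝ, 4 - (s + (b + r * I)) - ρ = -I * (r - t₀ : ℝ) := by
      intro r
      push_cast
      linear_combination -hu₀
    have ht : Tendsto (fun r : ℝ => 4 - (s + (b + r * I))) (nhdsWithin t₀ {t₀}ᶜ)
        (nhdsWithin ρ {ρ}ᶜ) := by
      refine tendsto_nhdsWithin_iff.mpr ⟨?_, ?_⟩
      · refine Tendsto.mono_left ?_ nhdsWithin_le_nhds
        have : Continuous fun r : ℝ => 4 - (s + ((b : ℂ) + r * I)) := by fun_prop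
        convert this.tendsto t₀ using 2
        rw [hu₀]
        ring
      · filter_upwards [self_mem_nhdsWithin] with r hr
        rw [Set.mem_compl_singleton_iff, ← sub_ne_zero, hz]
        exact mul_ne_zero (neg_ne_zero.mpr I_ne_zero)
          (by exact_mod_cast sub_ne_zero.mpr hr)
    have h1 := hO.comp_tendsto ht
    have hHt : Tendsto (fun r : ℝ => H (b + r * I)) (nhdsWithin t₀ {t₀}ᶜ)
        (nhds (H (b + t₀ * I))) := by
      refine Tendsto.mono_left ?_ nhdsWithin_le_nhds
      exact (hHc.comp (f := fun r : ℝ => (b : ℂ) + r * I) (by fun_prop)).tendsto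
    have h3 : (fun _ => (1 : ℂ)) =O[nhdsWithin t₀ {t₀}ᶜ] fun r : ℝ => H (b + r * I) :=
      (Asymptotics.isBigO_const_left_iff_pos_le_norm one_ne_zero).mpr
        ⟨‖H (b + t₀ * I)‖ / 2, by positivity,
          (hHt.norm.eventually (lt_mem_nhds (half_lt_self (by positivity)))).mono
            fun _ h => h.le⟩
    refine Asymptotics.IsBigO.trans ?_ (h3.mul h1)
    refine Asymptotics.IsBigO.of_bound 1 (Eventually.of_forall fun r => ?_)
    simp only [Function.comp_apply, hz, norm_mul, norm_inv, norm_neg, norm_I, norm_real, one_mul, le_refl]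
  rw [VI_eq_integral, MeasureTheory.integral_undef hni, mul_zero]

theorem rpow_mul_rpow_le {x y c ε : ℝ} (hx : 0 < x) (hxy : x < y) (h : 7 / 2 - ε ≤ c) :
    x ^ c * y ^ (3 - c) ≤ y ^ (-(1 / 2 : ℝ) + ε) * x ^ ((7 : ℝ) / 2 - ε) := by
  have hy := hx.trans hxy
  calc x ^ c * y ^ (3 - c) = x ^ (7 / 2 - ε) * x ^ (c - (7 / 2 - ε)) * y ^ (3 - c) := by
        rw [← Real.rpow_add hx, add_sub_cancel]
    _ ≤ x ^ (7 / 2 - ε) * y ^ (c - (7 / 2 - ε)) * y ^ (3 - c) := by gcongr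
    _ = _ := by
        rw [mul_assoc, ← Real.rpow_add hy, mul_comm]
        ring_nf

theorem exists_norm_VI_VI_factors_le_of_mellinQuot (hp : 0 < p) (hpq : p ≤ q)
    (hs : ContDiff ℝ (⊤ : ℕ∞) φ) (hφ : ∀ t ∉ Set.Icc p q, φ t = 0) {a b ε : ℝ} (ha : 1 < a)
    (ha' : a < 2) (hb : 1 < b) (hb' : b < 2) (hε : 7 / 2 - ε ≤ a + b)
    (h : ∃ K, ∀ w ∈ re ⁻¹' Set.Icc (4 - (a + b)) (4 - (a + b)),
      ‖mellinQuot φ w‖ ≤ K * (1 + |w.im|) ^ (-4 : ℝ)) :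
    ∃ C, ∀ x y : ℝ, 0 < x → x < y →
      ‖VI a fun s => VI b fun u => singleFactor φ s * singleFactor φ u *
        (coupledFactor φ (s + u) * ((x : ℂ) ^ (s + u) * (y : ℂ) ^ (3 - (s + u))))‖ ≤
        C * (y ^ (-(1 / 2 : ℝ) + ε) * x ^ ((7 : ℝ) / 2 - ε)) := by
  obtain ⟨K, hK⟩ := exists_norm_coupledFactor_le (by linarith) (by linarith) h
  obtain ⟨C, hC⟩ := exists_norm_VI_VI_factors_le hp hpq hs hφ ha ha' hb hb' (K := K)
    fun s hs => hK s (by simp [hs])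
  refine ⟨|C|, fun x y hx hxy => (hC x y hx (hx.trans hxy)).trans ?_⟩
  have := hx.trans hxy
  exact mul_le_mul (le_abs_self C) (rpow_mul_rpow_le hx hxy hε) (by positivity) (abs_nonneg C)

theorem RiemannHypothesis.exists_norm_VI_VI_factors_le (hRH : RiemannHypothesis) (hp : 0 < p)
    (hpq : p ≤ q) (hs : ContDiff ℝ (⊤ : ℕ∞) φ) (hφ : ∀ t ∉ Set.Icc p q, φ t = 0) {a b ε : ℝ}
    (ha : 1 < a) (ha' : a < 2) (hb : 1 < b) (hb' : b < 2) (hε : 0 < ε) :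
    ∃ C, ∀ x y : ℝ, 0 < x → x < y →
      ‖VI a fun s => VI b fun u => singleFactor φ s * singleFactor φ u *
        (coupledFactor φ (s + u) * ((x : ℂ) ^ (s + u) * (y : ℂ) ^ (3 - (s + u))))‖ ≤
        C * (y ^ (-(1 / 2 : ℝ) + ε) * x ^ ((7 : ℝ) / 2 - ε)) := by
  rcases lt_trichotomy (a + b) (7 / 2) with hab | hab | hab
  · set T := max (a + b) (7 / 2 - ε)
    have hT1 : a + b ≤ T := le_max_left _ _
    have hT2 : T < 7 / 2 := max_lt hab (by linarith)
    set θ := (T - (a + b)) / (4 - (a + b))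
    have hθ0 : 0 ≤ θ := div_nonneg (by linarith) (by linarith)
    have hθT : θ * (4 - (a + b)) = T - (a + b) := div_mul_cancel₀ _ (by linarith)
    have hsum : b + θ * (2 - b) + (a + θ * (2 - a)) = T := by linear_combination hθT
    have h1 : a ≤ a + θ * (2 - a) := le_add_of_nonneg_right (mul_nonneg hθ0 (by linarith))
    have h2 : b ≤ b + θ * (2 - b) := le_add_of_nonneg_right (mul_nonneg hθ0 (by linarith))
    have h3 : a + θ * (2 - a) < 2 := by nlinarith
    have h4 : b + θ * (2 - b) < 2 := by nlinarith
    obtain ⟨K, hK⟩ := hRH.exists_norm_mellinQuot_le_of_half_lt hp hpq hs hφ (b := 4 - T)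
      (by linarith) (by linarith)
    obtain ⟨C, hC⟩ := exists_norm_VI_VI_factors_le_of_mellinQuot hp hpq hs hφ
      (hb.trans_le h2) h4 (ha.trans_le h1) h3 (ε := ε) (by rw [hsum]; exact le_max_right _ _)
      ⟨K, fun w hw => hK w (by rw [hsum] at hw; exact ⟨hw.1, hw.2.trans (by linarith)⟩)⟩
    refine ⟨C, fun x y hx hxy => ?_⟩
    rw [hRH.VI_VI_factors_eq hp hpq hs hφ ha h1 h3 hb h2 h4 (by linarith) hx (hx.trans hxy)]
    exact hC x y hx hxy
  · rcases exists_differentiableOn_mul_eq_or_exists_isBigO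
      (differentiable_sub_one_mul_mellinW hp hs.continuous hφ) differentiable_riemannZeta₁
      (z₀ := 2) (hRH.riemannZeta₁_ne_zero (by norm_num) (by norm_num))
      {w | 1 / 4 < w.re} with ⟨g, hg, hgm⟩ | ⟨ρ, hρ, hρ0, hO⟩
    · obtain ⟨K, hK⟩ := exists_norm_mellinQuot_le hp hpq hs hφ (a := 1 / 4) (b := 1 / 2)
        (by norm_num) (by norm_num) (by norm_num) hg hgm
      refine exists_norm_VI_VI_factors_le_of_mellinQuot hp hpq hs hφ ha ha' hb hb' (by linarith)
        ⟨K, fun w hw => hK w ⟨le_trans (by linarith) hw.1, hw.2.trans (by linarith)⟩⟩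
    · refine ⟨0, fun x y hx hxy => ?_⟩
      rw [hRH.VI_VI_factors_eq_zero hp hs.continuous hφ ha' hb' hab hx (hx.trans hxy)
        (hRH.re_eq_half_of_riemannZeta₁_eq_zero
          (by have : 1 / 4 < ρ.re := hρ; linarith) hρ0) hO]
      simp
  · exact exists_norm_VI_VI_factors_le_of_mellinQuot hp hpq hs hφ ha ha' hb hb' (by linarith)
      (hRH.exists_norm_mellinQuot_le_of_lt_half hp hpq hs hφ (by linarith) (by linarith))

end Assembly

/-- Under RH, the bound `C₄ ≪ y^{-1/2+ε} x^{7/2-ε}`. -/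
theorem C4_bound (hRH : RiemannHypothesis) (ε : ℝ) (hε : 0 < ε)
    (U : ℝ) (hU : 2 ≤ U) (W : Weight U)
    (c₁ c₂ : ℝ) (h1 : 1 < c₁) (h12 : c₁ < c₂) (h2 : c₂ < 2) :
    ∃ C : ℝ, 0 < C ∧ ∃ X : ℝ, ∀ x y : ℝ, X ≤ x → x < y →
      ‖VI c₁ (fun s₁ => VI c₂ (fun s₂ =>
          riemannZeta (3 - s₁ - s₂) * riemannZeta (2 - s₁) * riemannZeta (2 - s₂) /
              (riemannZeta (4 - (s₁ + s₂)) * riemannZeta s₁ * riemannZeta s₂) *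
            (y : ℂ) ^ (3 - s₁ - s₂) * (x : ℂ) ^ (s₁ + s₂) *
            mellinW W.toFun (3 - s₁ - s₂) * mellinW W.toFun s₁ * mellinW W.toFun s₂))‖ ≤
        C * (y ^ (-(1 / 2 : ℝ) + ε) * x ^ ((7 : ℝ) / 2 - ε)) := by
  have hp : 0 < 1 / (2 * U) := by positivity
  have hU1 : 1 / (2 * U) ≤ 1 + 1 / (2 * U) := by linarith
  obtain ⟨C, hC⟩ := hRH.exists_norm_VI_VI_factors_le hp hU1 W.smooth W.support_subset
    h1 (h12.trans h2) (h1.trans h12) h2 hε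
  refine ⟨|C| + 1, by positivity, 1, fun x y hx hxy => ?_⟩
  have hx0 : 0 < x := by linarith
  have hy0 := hx0.trans hxy
  rw [VI_VI_eq_factors]
  refine (hC x y hx0 hxy).trans ?_
  gcongr
  linarith [le_abs_self C]
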